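/- arXiv:1505.06978 — 2 statements merged into one kernel-verified Lean document; each statement's English description precedes it below -/
import Mathlib

section
/- Let n ≥ 5. Assume the blow-up setup with 1 ≤ p < n/(n−2), and assume in addition: d_k → 0; there is C₀ > 0 such that v_k(y) ≤ C₀ λ_k^{n/(p+1)} (1+λ_k|y−x_k|)^{2−n} for all y ∈ Ω and all k; and there are constants δ > 0, A > 0 and positive reals A_k with A_k → A such that |λ_k^{n/(q_k+1)} v_k(y) − A_k G(y,x_k)| ≤ C₀ N_k^{−δ} |y−x_k|^{−(n−2)} for all k and all y ∈ Ω with |y−x_k| ≥ 2d_k/√N_k. Define G̃(x,y) := ∫_Ω G(x,z) G(z,y)^p dz. Then each u_k is differentiable on Ω and there is a sequence η_k ≥ 0 with η_k → 0 such that for all k and all x with |x−x_k| = 2d_k: |u_k(x) − A_k^p λ_k^{−np/(q_k+1)} G̃(x,x_k)| ≤ η_k λ_k^{−np/(q_k+1)} d_k^{−((n−2)p−2)} and |∇_x u_k(x) − A_k^p λ_k^{−np/(q_k+1)} ∇_x G̃(x,x_k)| ≤ η_k λ_k^{−np/(q_k+1)} d_k^{−((n−2)p−1)}. -/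
open MeasureTheory Metric Filter Topology RealInnerProductSpace

noncomputable section

abbrev Euc (n : ℕ) := EuclideanSpace ℝ (Fin n)

noncomputable def surf (n : ℕ) : Measure (Euc n) := μH[(n : ℝ) - 1]

noncomputable def omegaSph (n : ℕ) : ℝ := (surf n (sphere (0 : Euc n) 1)).toReal

/-- `c_n = 1/((n-2) ω_{n-1})`. -/
noncomputable def cGreen (n : ℕ) : ℝ := 1 / (((n : ℝ) - 2) * omegaSph n)

/-- Laplacian on `ℝⁿ`. -/
noncomputable def lap (n : ℕ) (u : Euc n → ℝ) (x : Euc n) : ℝ :=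
  ∑ i : Fin n, fderiv ℝ (fun y => fderiv ℝ u y (EuclideanSpace.single i 1)) x
    (EuclideanSpace.single i 1)

/-- The blow-up setup: a bounded open set `Ω ⊆ ℝⁿ` with a Green-type kernel `G`
(with regular part `H`), exponents `p, q` on the critical hyperbola, perturbed exponents
`q_k` with `ε_k → 0`, positive solutions `(u_k, v_k)` of the integral form of the Lane–Emden
system, maximum values `λ_k` attained at `x_k`, with `λ_k → ∞`, `N_k = λ_k d_k → ∞` and
`λ_k^{ε_k}` bounded. -/
structure BlowupSetup (n : ℕ) where
  Ω : Set (Euc n)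
  hΩo : IsOpen Ω
  hΩb : Bornology.IsBounded Ω
  G : Euc n → Euc n → ℝ
  H : Euc n → Euc n → ℝ
  Gsymm : ∀ x y, G x y = G y x
  Gdecomp : ∀ x ∈ Ω, ∀ y ∈ Ω, x ≠ y →
    G x y = cGreen n * ‖x - y‖ ^ ((2 : ℝ) - n) - H x y
  Hharm : ∀ y ∈ Ω, ContDiffOn ℝ 2 (fun x => H x y) Ω ∧
    ∀ x ∈ Ω, lap n (fun z => H z y) x = 0
  Gpos : ∀ x ∈ Ω, ∀ y ∈ Ω, x ≠ y → 0 < G x y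
  Gle : ∀ x ∈ Ω, ∀ y ∈ Ω, x ≠ y → G x y ≤ cGreen n * ‖x - y‖ ^ ((2 : ℝ) - n)
  p : ℝ
  hp : 1 ≤ p
  q : ℝ
  hq : 0 < q
  hpq : 1 / (p + 1) + 1 / (q + 1) = ((n : ℝ) - 2) / n
  eps : ℕ → ℝ
  heps : ∀ k, 0 < eps k
  heps0 : Filter.Tendsto eps Filter.atTop (nhds 0)
  qk : ℕ → ℝ
  hqk : ∀ k, 0 < qk k
  hqk_eq : ∀ k, 1 / (p + 1) + 1 / (qk k + 1) = ((n : ℝ) - 2) / n + eps k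
  u : ℕ → Euc n → ℝ
  v : ℕ → Euc n → ℝ
  hu_cont : ∀ k, ContinuousOn (u k) Ω
  hv_cont : ∀ k, ContinuousOn (v k) Ω
  hu_pos : ∀ k, ∀ x ∈ Ω, 0 < u k x
  hv_pos : ∀ k, ∀ x ∈ Ω, 0 < v k x
  hu_eq : ∀ k, ∀ x ∈ Ω, u k x = ∫ y in Ω, G x y * (v k y) ^ p
  hv_eq : ∀ k, ∀ x ∈ Ω, v k x = ∫ y in Ω, G x y * (u k y) ^ qk k
  lam : ℕ → ℝ
  xk : ℕ → Euc n
  hxk : ∀ k, xk k ∈ Ω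
  hlam_eq : ∀ k,
    lam k = max ((v k (xk k)) ^ ((p + 1) / n)) ((u k (xk k)) ^ ((qk k + 1) / n))
  hlam_sup : ∀ k, ∀ x ∈ Ω,
    max ((v k x) ^ ((p + 1) / n)) ((u k x) ^ ((qk k + 1) / n)) ≤ lam k
  hlam_top : Filter.Tendsto lam Filter.atTop Filter.atTop
  hN_top : Filter.Tendsto (fun k => lam k * (Metric.infDist (xk k) (frontier Ω) / 4))
    Filter.atTop Filter.atTop
  hlam_eps : ∃ C : ℝ, ∀ k, lam k ^ eps k ≤ C

namespace BlowupSetup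

variable {n : ℕ}

/-- `d_k = dist(x_k, ∂Ω)/4`. -/
noncomputable def d (S : BlowupSetup n) (k : ℕ) : ℝ :=
  Metric.infDist (S.xk k) (frontier S.Ω) / 4

/-- `N_k = λ_k d_k`. -/
noncomputable def N (S : BlowupSetup n) (k : ℕ) : ℝ := S.lam k * S.d k

end BlowupSetup

theorem nonneg_of_isLocalMin_of_hasDerivAt {g g' : ℝ → ℝ} {a b : ℝ} (hmin : IsLocalMin g a)
    (hg : ∀ᶠ t in 𝓝 a, HasDerivAt g (g' t) t) (hg' : HasDerivAt g' b a) : 0 ≤ b := by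
  by_contra! hb
  have hd : deriv g =ᶠ[𝓝 a] g' := hg.mono fun t ht => ht.deriv
  have h2 : deriv (deriv g) a = b := by rw [hd.deriv_eq, hg'.deriv]
  have hmax := isLocalMax_of_deriv_deriv_neg (by rwa [h2]) hmin.deriv_eq_zero
    hg.self_of_nhds.continuousAt
  have hc : g =ᶠ[𝓝 a] fun _ => g a := by
    filter_upwards [hmin, hmax] with t h1 h2 using le_antisymm h2 h1
  have h0 : deriv g =ᶠ[𝓝 a] fun _ => 0 := by simpa using hc.deriv
  rw [h0.deriv_eq, deriv_const] at h2
  linarith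

section Line

variable {E : Type*} [NormedAddCommGroup E] [NormedSpace ℝ E]

theorem tendsto_add_smul_nhds_zero (z e : E) : Tendsto (fun t : ℝ => z + t • e) (𝓝 0) (𝓝 z) := by
  have : Continuous fun t : ℝ => z + t • e := by fun_prop
  simpa using this.tendsto 0

theorem hasDerivAt_add_smul (z e : E) (t : ℝ) : HasDerivAt (fun t : ℝ => z + t • e) e t := by
  simpa using ((hasDerivAt_id t).smul_const e).const_add z

theorem eventually_hasDerivAt_line {h : E → ℝ} {U : Set E} (hU : IsOpen U)
    (hh : ContDiffOn ℝ 2 h U) {z : E} (hz : z ∈ U) (e : E) :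
    ∀ᶠ t : ℝ in 𝓝 0, HasDerivAt (fun t : ℝ => h (z + t • e)) (fderiv ℝ h (z + t • e) e) t := by
  filter_upwards [(tendsto_add_smul_nhds_zero z e).eventually (hU.mem_nhds hz)] with t ht
  have := ((hh.contDiffAt (hU.mem_nhds ht)).differentiableAt (by norm_num)).hasFDerivAt
  exact this.comp_hasDerivAt t (hasDerivAt_add_smul z e t)

theorem hasDerivAt_fderiv_line {h : E → ℝ} {U : Set E} (hU : IsOpen U)
    (hh : ContDiffOn ℝ 2 h U) {z : E} (hz : z ∈ U) (e : E) :
    HasDerivAt (fun t : ℝ => fderiv ℝ h (z + t • e) e)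
      (fderiv ℝ (fun y => fderiv ℝ h y e) z e) 0 := by
  have h1 : ContDiffAt ℝ 1 (fderiv ℝ h) z :=
    (hh.contDiffAt (hU.mem_nhds hz)).fderiv_right (by norm_num)
  have h2 : DifferentiableAt ℝ (fun y => fderiv ℝ h y e) z :=
    (h1.differentiableAt (by norm_num)).clm_apply (differentiableAt_const e)
  have h3 : HasFDerivAt (fun y => fderiv ℝ h y e) (fderiv ℝ (fun y => fderiv ℝ h y e) z)
      (z + (0 : ℝ) • e) := by simpa using h2.hasFDerivAt
  exact h3.comp_hasDerivAt 0 (hasDerivAt_add_smul z e 0)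

end Line

/-- A comparison function dominates the odd part of a harmonic function across a coordinate
hyperplane. -/
theorem sub_reflected_le_of_lap_eq_zero {n : ℕ} {h : Euc n → ℝ} {x : Euc n} {R ρ M : ℝ}
    (hρ : 0 < ρ) (hρR : ρ < R) (hM : 0 < M) (hh : ContDiffOn ℝ 2 h (ball x R))
    (hl : ∀ z ∈ ball x R, lap n h z = 0) (hb : ∀ z ∈ ball x R, |h z| ≤ M) (i : Fin n)
    {t : ℝ} (ht : 0 ≤ t) (htρ : t ≤ ρ) :
    h (x + t • EuclideanSpace.single i 1) - h (x - t • EuclideanSpace.single i 1) ≤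
      2 * M / ρ ^ 2 * (t ^ 2 + (n + 1) * (t * (ρ - t))) := by
  set e : Fin n → Euc n := fun j => EuclideanSpace.single j 1 with he
  set L : Euc n ≃ₗᵢ[ℝ] Euc n := (Submodule.span ℝ {e i})ᗮ.reflection with hL
  set σ : Euc n → Euc n := fun z => x + L (z - x) with hσ
  have hLi : L (e i) = - e i := by
    rw [hL, Submodule.reflection_mem_subspace_orthogonalComplement_eq_neg]
    simp
  have hLfix : ∀ z : Euc n, z i = 0 → L z = z := by
    intro z hz
    rw [hL, Submodule.reflection_eq_self_iff, Submodule.mem_orthogonal_singleton_iff_inner_right]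
    simp [he, EuclideanSpace.inner_single_left, hz]
  have hLj : ∀ j, j ≠ i → L (e j) = e j := fun j hj => hLfix _ (by simp [he, hj.symm])
  have hσn : ∀ z, ‖σ z - x‖ = ‖z - x‖ := fun z => by
    simp only [hσ, add_sub_cancel_left, L.norm_map]
  set w : Euc n → ℝ := fun z => 2 * M / ρ ^ 2 *
    (‖z - x‖ ^ 2 + (n + 1) * ((z i - x i) * (ρ - (z i - x i)))) - (h z - h (σ z)) with hw
  set K : Set (Euc n) := closedBall x ρ ∩ {z | x i ≤ z i} with hK
  have hKc : IsCompact K := (isCompact_closedBall x ρ).inter_right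
    (isClosed_le continuous_const (by fun_prop))
  have hKR : ∀ z ∈ K, z ∈ ball x R := fun z hz => closedBall_subset_ball hρR hz.1
  have hσR : ∀ z ∈ ball x R, σ z ∈ ball x R := fun z hz => by
    rw [mem_ball_iff_norm] at hz ⊢; rwa [hσn]
  have hLc : Continuous σ := by fun_prop
  have hwc : ContinuousOn w K := by
    have h1 : ContinuousOn h K := hh.continuousOn.mono hKR
    have h2 : ContinuousOn (fun z => h (σ z)) K :=
      hh.continuousOn.comp hLc.continuousOn fun z hz => hσR z (hKR z hz)
    have h3 : Continuous fun z : Euc n => 2 * M / ρ ^ 2 *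
      (‖z - x‖ ^ 2 + (n + 1) * ((z i - x i) * (ρ - (z i - x i)))) := by fun_prop
    exact h3.continuousOn.sub (h1.sub h2)
  have hti : ∀ s : ℝ, ‖x + s • e i - x‖ = |s| := fun s => by simp [he, norm_smul]
  have htK : x + t • e i ∈ K := by
    refine ⟨?_, ?_⟩
    · rw [mem_closedBall_iff_norm, hti, abs_of_nonneg ht]; exact htρ
    · simp [he, ht]
  obtain ⟨z₀, hz₀, hmin⟩ := hKc.exists_isMinOn ⟨_, htK⟩ hwc
  have hcoord : ∀ z : Euc n, |z i - x i| ≤ ‖z - x‖ := fun z => by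
    simpa using PiLp.norm_apply_le (z - x) i
  have key : 0 ≤ w z₀ := by
    by_contra! hneg
    have hn1 : ‖z₀ - x‖ ≤ ρ := mem_closedBall_iff_norm.1 hz₀.1
    have hc1 : 0 ≤ z₀ i - x i := sub_nonneg.2 hz₀.2
    have hc2 : z₀ i - x i ≤ ρ := (le_abs_self _).trans ((hcoord z₀).trans hn1)
    have hprod : 0 ≤ ((n : ℝ) + 1) * ((z₀ i - x i) * (ρ - (z₀ i - x i))) :=
      mul_nonneg (by positivity) (mul_nonneg hc1 (by linarith))
    have hi : x i < z₀ i := by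
      by_contra! hle
      have h0 : z₀ i - x i = 0 := le_antisymm (by linarith) hc1
      have : σ z₀ = z₀ := by simp only [hσ]; rw [hLfix _ (by simpa using h0)]; abel
      have : 0 ≤ w z₀ := by
        simp only [hw, this, sub_self, sub_zero]; positivity
      linarith
    have hs : ‖z₀ - x‖ < ρ := by
      refine lt_of_le_of_ne hn1 fun heq => ?_
      have hA := hb _ (hKR _ hz₀)
      have hB := hb _ (hσR _ (hKR _ hz₀))
      have : 2 * M ≤ 2 * M / ρ ^ 2 *
          (‖z₀ - x‖ ^ 2 + (n + 1) * ((z₀ i - x i) * (ρ - (z₀ i - x i)))) := by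
        rw [heq]
        calc 2 * M = 2 * M / ρ ^ 2 * (ρ ^ 2) := by field_simp
          _ ≤ _ := by gcongr; linarith
      simp only [hw] at hneg
      rw [abs_le] at hA hB
      linarith
    have hKn : K ∈ 𝓝 z₀ := by
      refine inter_mem (closedBall_mem_nhds_of_mem (mem_ball_iff_norm.2 hs)) ?_
      have : IsOpen {z : Euc n | x i < z i} := isOpen_lt continuous_const (by fun_prop)
      exact mem_of_superset (this.mem_nhds hi) fun z hz => (show x i < z i from hz).le
    have hlm : IsLocalMin w z₀ := hmin.isLocalMin hKn
    have hzR := hKR _ hz₀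
    have hsR := hσR _ hzR
    have hj : ∀ j, 0 ≤ 2 * M / ρ ^ 2 * (2 - 2 * (n + 1) * (if j = i then 1 else 0))
        - (fderiv ℝ (fun y => fderiv ℝ h y (e j)) z₀ (e j)
          - fderiv ℝ (fun y => fderiv ℝ h y (e j)) (σ z₀) (e j)) := by
      intro j
      have hD : fderiv ℝ (fun y => fderiv ℝ h y (e j)) (σ z₀) (e j)
          = fderiv ℝ (fun y => fderiv ℝ h y (L (e j))) (σ z₀) (L (e j)) := by
        by_cases hji : j = i
        · subst hji; simp [hLi]
        · rw [hLj j hji]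
      rw [hD]
      set c : ℝ := if j = i then 1 else 0 with hc
      have hgl : IsLocalMin (fun s : ℝ => w (z₀ + s • e j)) 0 := by
        have := (tendsto_add_smul_nhds_zero z₀ (e j)).eventually hlm
        filter_upwards [this] with s hs'
        simpa using hs'
      have hexp : ∀ s : ℝ, w (z₀ + s • e j) = 2 * M / ρ ^ 2 *
          ((‖z₀ - x‖ ^ 2 + 2 * s * (z₀ j - x j) + s ^ 2) +
            (n + 1) * ((z₀ i - x i + c * s) * (ρ - (z₀ i - x i + c * s))))
          - (h (z₀ + s • e j) - h (σ z₀ + s • L (e j))) := by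
        intro s
        have h1 : σ (z₀ + s • e j) = σ z₀ + s • L (e j) := by
          simp only [hσ, add_sub_right_comm, map_add, map_smul, add_assoc]
        have h2 : ‖z₀ + s • e j - x‖ ^ 2 = ‖z₀ - x‖ ^ 2 + 2 * s * (z₀ j - x j) + s ^ 2 := by
          rw [add_sub_right_comm, norm_add_sq_real, norm_smul, inner_smul_right]
          simp [he, EuclideanSpace.inner_single_right]
          ring
        have h3 : (z₀ + s • e j) i = z₀ i + c * s := by
          by_cases hji : j = i
          · subst hji; simp [he, hc]
          · simp [he, hc, hji, Ne.symm hji]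
        simp only [hw, h1, h2, h3]
        ring
      refine nonneg_of_isLocalMin_of_hasDerivAt (g' := fun s => 2 * M / ρ ^ 2 *
          ((2 * (z₀ j - x j) + 2 * s) +
            (n + 1) * (c * (ρ - (z₀ i - x i)) - c * (z₀ i - x i) - 2 * c * s))
          - (fderiv ℝ h (z₀ + s • e j) (e j) - fderiv ℝ h (σ z₀ + s • L (e j)) (L (e j))))
          hgl ?_ ?_
      · filter_upwards [eventually_hasDerivAt_line isOpen_ball hh hzR (e j),
          eventually_hasDerivAt_line isOpen_ball hh hsR (L (e j))] with s h1 h2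
        have hcc : c * c = c := by simp [hc]
        have hpoly : HasDerivAt (fun s : ℝ => 2 * M / ρ ^ 2 *
          ((‖z₀ - x‖ ^ 2 + 2 * s * (z₀ j - x j) + s ^ 2) +
            (n + 1) * ((z₀ i - x i + c * s) * (ρ - (z₀ i - x i + c * s)))))
            (2 * M / ρ ^ 2 * ((2 * (z₀ j - x j) + 2 * s) +
            (n + 1) * (c * (ρ - (z₀ i - x i)) - c * (z₀ i - x i) - 2 * c * s))) s := by
          have hs0 := hasDerivAt_id s
          have hA := (hs0.const_mul c).const_add (z₀ i - x i)
          have := (((((hs0.const_mul 2).mul_const (z₀ j - x j)).const_add (‖z₀ - x‖ ^ 2)).add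
            (hs0.pow 2)).add ((hA.mul (hA.const_sub ρ)).const_mul ((n : ℝ) + 1))).const_mul
              (2 * M / ρ ^ 2)
          refine this.congr_deriv ?_
          simp only [id, Nat.cast_ofNat]
          linear_combination (2 * M / ρ ^ 2) * (n + 1) * (-2 * s) * hcc
        have := hpoly.sub (h1.sub h2)
        exact this.congr_of_eventuallyEq (Eventually.of_forall hexp)
      · have hpoly : HasDerivAt (fun s : ℝ => 2 * M / ρ ^ 2 * ((2 * (z₀ j - x j) + 2 * s) +
            (n + 1) * (c * (ρ - (z₀ i - x i)) - c * (z₀ i - x i) - 2 * c * s)))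
            (2 * M / ρ ^ 2 * (2 - 2 * (n + 1) * c)) 0 := by
          have hs0 := hasDerivAt_id (0 : ℝ)
          have := (((hs0.const_mul 2).const_add (2 * (z₀ j - x j))).add
            (((hs0.const_mul (2 * c)).const_sub
              (c * (ρ - (z₀ i - x i)) - c * (z₀ i - x i))).const_mul ((n : ℝ) + 1))).const_mul
              (2 * M / ρ ^ 2)
          refine this.congr_deriv ?_
          ring
        exact hpoly.sub ((hasDerivAt_fderiv_line isOpen_ball hh hzR (e j)).sub
          (hasDerivAt_fderiv_line isOpen_ball hh hsR (L (e j))))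
    have hsum := Finset.sum_nonneg fun j (_ : j ∈ Finset.univ) => hj j
    have hl1 := hl _ hzR
    have hl2 := hl _ hsR
    simp only [lap] at hl1 hl2
    simp only [Finset.sum_sub_distrib, ← Finset.mul_sum] at hsum
    simp only [he] at hsum
    rw [hl1, hl2] at hsum
    simp at hsum
    have : 0 < M / ρ ^ 2 := by positivity
    have h2 : 2 * M / ρ ^ 2 = 2 * (M / ρ ^ 2) := by ring
    rw [h2] at hsum
    nlinarith
  have hfin : 0 ≤ w (x + t • e i) := key.trans (hmin htK)
  have h1 : σ (x + t • e i) = x - t • e i := by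
    simp [hσ, hLi, sub_eq_add_neg]
  have h2 : (x + t • e i) i - x i = t := by simp [he]
  simp only [hw, h1, h2, hti, sq_abs] at hfin
  linarith

theorem fderiv_single_le_of_lap_eq_zero {n : ℕ} {h : Euc n → ℝ} {x : Euc n} {R ρ M : ℝ}
    (hρ : 0 < ρ) (hρR : ρ < R) (hM : 0 < M) (hh : ContDiffOn ℝ 2 h (ball x R))
    (hl : ∀ z ∈ ball x R, lap n h z = 0) (hb : ∀ z ∈ ball x R, |h z| ≤ M) (i : Fin n) :
    fderiv ℝ h x (EuclideanSpace.single i 1) ≤ (n + 1) * M / ρ := by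
  set e : Euc n := EuclideanSpace.single i 1
  have hx : x ∈ ball x R := mem_ball_self (hρ.trans hρR)
  have h1 := (eventually_hasDerivAt_line isOpen_ball hh hx e).self_of_nhds
  have h2 := (eventually_hasDerivAt_line isOpen_ball hh hx (-e)).self_of_nhds
  have hs0 := hasDerivAt_id (0 : ℝ)
  have h3 := ((hs0.pow 2).add ((hs0.mul (hs0.const_sub ρ)).const_mul ((n : ℝ) + 1))).const_mul
              (2 * M / ρ ^ 2)
  have h4 := (h3.sub (h1.sub h2)).tendsto_slope_zero_right
  have h5 := ge_of_tendsto h4 (b := 0) (by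
    filter_upwards [Ioc_mem_nhdsGT hρ] with t ht
    have := sub_reflected_le_of_lap_eq_zero hρ hρR hM hh hl hb i ht.1.le ht.2
    refine smul_nonneg (inv_nonneg.2 ht.1.le) ?_
    simp only [sub_eq_add_neg x] at this
    simp [id]
    linarith)
  simp at h5
  have : 2 * M / ρ ^ 2 * (((n : ℝ) + 1) * ρ) = 2 * ((n + 1) * M / ρ) := by field_simp
  linarith

theorem norm_le_sum_apply_single {n : ℕ} (L : Euc n →L[ℝ] ℝ) {C : ℝ}
    (hL : ∀ i, |L (EuclideanSpace.single i 1)| ≤ C) : ‖L‖ ≤ n * C := by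
  rcases Nat.eq_zero_or_pos n with rfl | hn
  · have : L = 0 := by ext v; rw [Subsingleton.elim v 0]; simp
    simp [this]
  have hC : 0 ≤ C := (abs_nonneg _).trans (hL ⟨0, hn⟩)
  refine L.opNorm_le_bound (by positivity) fun v => ?_
  have hv : v = ∑ i, v i • EuclideanSpace.single i (1 : ℝ) := by
    ext j; simp [Pi.single_apply]
  conv_lhs => rw [hv]
  rw [map_sum]
  calc ‖∑ i, L (v i • EuclideanSpace.single i (1 : ℝ))‖
      ≤ ∑ i : Fin n, ‖v‖ * C := by
        refine norm_sum_le_of_le _ fun i _ => ?_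
        rw [map_smul, smul_eq_mul, norm_mul]
        exact mul_le_mul (PiLp.norm_apply_le v i) (hL i) (norm_nonneg _) (norm_nonneg _)
    _ = n * C * ‖v‖ := by simp; ring

/-- Interior gradient estimate for harmonic functions. -/
theorem norm_fderiv_le_of_lap_eq_zero {n : ℕ} {h : Euc n → ℝ} {x : Euc n} {R M : ℝ}
    (hR : 0 < R) (hM : 0 < M) (hh : ContDiffOn ℝ 2 h (ball x R))
    (hl : ∀ z ∈ ball x R, lap n h z = 0) (hb : ∀ z ∈ ball x R, |h z| ≤ M) :
    ‖fderiv ℝ h x‖ ≤ 2 * n * (n + 1) * M / R := by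
  have hR2 : 0 < R / 2 := by positivity
  have hR2' : R / 2 < R := by linarith
  have key := norm_le_sum_apply_single (fderiv ℝ h x) (C := (n + 1) * M / (R / 2)) fun i => by
    refine abs_le.2 ⟨?_, fderiv_single_le_of_lap_eq_zero hR2 hR2' hM hh hl hb i⟩
    have := fderiv_single_le_of_lap_eq_zero (h := fun z => -h z) hR2 hR2' hM hh.neg
      (fun z hz => ?_) (fun z hz => by simpa using hb z hz) i
    · simp only [fderiv_fun_neg, neg_apply] at this
      linarith
    · have := hl z hz
      simp only [lap] at this ⊢
      simp [fderiv_fun_neg, this]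
  calc _ ≤ _ := key
    _ = _ := by field_simp

theorem exists_integral_ball_norm_rpow_le {n : ℕ} (hn : 0 < n) {b : ℝ} (hb : b < n) :
    ∃ C : ℝ, 0 ≤ C ∧ ∀ (r : ℝ), 0 < r → ∀ x : Euc n,
      IntegrableOn (fun y => ‖x - y‖ ^ (-b)) (ball x r) ∧
      ∫ y in ball x r, ‖x - y‖ ^ (-b) ≤ C * r ^ ((n : ℝ) - b) := by
  have : Nonempty (Fin n) := ⟨⟨0, hn⟩⟩
  set c : ℝ := n * (volume : Measure (Euc n)).real (ball 0 1)
  refine ⟨c / (n - b), div_nonneg (by positivity) (by linarith), fun r hr x => ?_⟩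
  set f : ℝ → ℝ := (Set.Iio r).indicator fun t => t ^ (-b) with hf
  have heq : ∀ y : Euc n, (ball x r).indicator (fun y => ‖x - y‖ ^ (-b)) y = f ‖y - x‖ := fun y => by
    simp [hf, Set.indicator, dist_eq_norm, norm_sub_rev]
  have hpow : Set.EqOn (fun t : ℝ => t ^ (Module.finrank ℝ (Euc n) - 1) • f t)
      ((Set.Iio r).indicator fun t => t ^ ((n : ℝ) - 1 - b)) (Set.Ioi 0) := by
    intro t ht
    by_cases htr : t < r
    · simp only [hf, Set.indicator_of_mem (Set.mem_Iio.2 htr), finrank_euclideanSpace,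
        Fintype.card_fin, smul_eq_mul]
      rw [← Real.rpow_natCast, ← Real.rpow_add ht, Nat.cast_sub hn]
      congr 1; push_cast; ring
    · simp [hf, htr]
  have hii : IntegrableOn (fun t : ℝ => t ^ ((n : ℝ) - 1 - b)) (Set.Ioo 0 r) :=
    (intervalIntegral.integrableOn_Ioo_rpow_iff hr).2 (by linarith)
  have hintg : Integrable (fun y : Euc n => f ‖y‖) := by
    rw [integrable_fun_norm_addHaar, integrableOn_congr_fun hpow measurableSet_Ioi, IntegrableOn,
      integrable_indicator_iff measurableSet_Iio, IntegrableOn,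
      Measure.restrict_restrict measurableSet_Iio, Set.inter_comm, Set.Ioi_inter_Iio]
    exact hii
  constructor
  · rw [← integrable_indicator_iff measurableSet_ball]
    simp_rw [funext heq]
    exact hintg.comp_sub_right x
  · rw [← integral_indicator measurableSet_ball]
    simp_rw [heq]
    rw [integral_sub_right_eq_self (fun y : Euc n => f ‖y‖) x, integral_fun_norm_addHaar,
      setIntegral_congr_fun measurableSet_Ioi hpow, integral_indicator measurableSet_Iio,
      Measure.restrict_restrict measurableSet_Iio, Set.inter_comm, Set.Ioi_inter_Iio,
      ← integral_Ioc_eq_integral_Ioo, ← intervalIntegral.integral_of_le hr.le,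
      integral_rpow (Or.inl (by linarith)), finrank_euclideanSpace, Fintype.card_fin,
      Real.zero_rpow (by linarith)]
    simp only [c]
    rw [show (n : ℝ) - 1 - b + 1 = n - b by ring]
    rw [sub_zero, nsmul_eq_mul, smul_eq_mul]
    apply le_of_eq; ring

theorem exists_integral_compl_ball_norm_rpow_le {n : ℕ} (hn : 0 < n) {b : ℝ} (hb : (n : ℝ) < b) :
    ∃ C : ℝ, 0 ≤ C ∧ ∀ (r : ℝ), 0 < r → ∀ x : Euc n,
      IntegrableOn (fun y => ‖x - y‖ ^ (-b)) (ball x r)ᶜ ∧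
      ∫ y in (ball x r)ᶜ, ‖x - y‖ ^ (-b) ≤ C * r ^ ((n : ℝ) - b) := by
  have : Nonempty (Fin n) := ⟨⟨0, hn⟩⟩
  set c : ℝ := n * (volume : Measure (Euc n)).real (ball 0 1)
  refine ⟨c / (b - n), div_nonneg (by positivity) (by linarith), fun r hr x => ?_⟩
  set f : ℝ → ℝ := (Set.Ici r).indicator fun t => t ^ (-b) with hf
  have heq : ∀ y : Euc n, (ball x r)ᶜ.indicator (fun y => ‖x - y‖ ^ (-b)) y = f ‖y - x‖ :=
    fun y => by simp [hf, Set.indicator, dist_eq_norm, norm_sub_rev]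
  have hpow : Set.EqOn (fun t : ℝ => t ^ (Module.finrank ℝ (Euc n) - 1) • f t)
      ((Set.Ici r).indicator fun t => t ^ ((n : ℝ) - 1 - b)) (Set.Ioi 0) := by
    intro t ht
    by_cases htr : r ≤ t
    · simp only [hf, Set.indicator_of_mem (Set.mem_Ici.2 htr), finrank_euclideanSpace,
        Fintype.card_fin, smul_eq_mul]
      rw [← Real.rpow_natCast, ← Real.rpow_add ht, Nat.cast_sub hn]
      congr 1; push_cast; ring
    · simp [hf, htr]
  have hset : Set.Ici r ∩ Set.Ioi 0 = Set.Ici r :=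
    Set.inter_eq_left.2 fun t ht => hr.trans_le ht
  have hii : IntegrableOn (fun t : ℝ => t ^ ((n : ℝ) - 1 - b)) (Set.Ioi r) :=
    integrableOn_Ioi_rpow_of_lt (by linarith) hr
  have hintg : Integrable (fun y : Euc n => f ‖y‖) := by
    rw [integrable_fun_norm_addHaar, integrableOn_congr_fun hpow measurableSet_Ioi, IntegrableOn,
      integrable_indicator_iff measurableSet_Ici, IntegrableOn,
      Measure.restrict_restrict measurableSet_Ici, hset]
    exact (integrableOn_Ici_iff_integrableOn_Ioi (by simp)).2 hii
  constructor
  · rw [← integrable_indicator_iff measurableSet_ball.compl]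
    simp_rw [funext heq]
    exact hintg.comp_sub_right x
  · rw [← integral_indicator measurableSet_ball.compl]
    simp_rw [heq]
    rw [integral_sub_right_eq_self (fun y : Euc n => f ‖y‖) x, integral_fun_norm_addHaar,
      setIntegral_congr_fun measurableSet_Ioi hpow, integral_indicator measurableSet_Ici,
      Measure.restrict_restrict measurableSet_Ici, hset,
      integral_Ici_eq_integral_Ioi, integral_Ioi_rpow_of_lt (by linarith) hr,
      finrank_euclideanSpace, Fintype.card_fin]
    simp only [c]
    rw [show (n : ℝ) - 1 - b + 1 = -(b - n) by ring, show (n : ℝ) - b = -(b - n) by ring,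
      neg_div_neg_eq, nsmul_eq_mul, smul_eq_mul]
    apply le_of_eq; ring

theorem exists_integral_two_point_kernel_le {n : ℕ} (hn : 0 < n) {a β : ℝ}
    (han : a < n) (hβn : β < n) (haβ : (n : ℝ) < a + β) :
    ∃ C : ℝ, 0 ≤ C ∧ ∀ (d : ℝ), 0 < d → ∀ x x₀ : Euc n, ‖x - x₀‖ = 2 * d →
      Integrable (fun y => ‖x - y‖ ^ (-a) * ‖x₀ - y‖ ^ (-β)) ∧
      ∫ y, ‖x - y‖ ^ (-a) * ‖x₀ - y‖ ^ (-β) ≤ C * d ^ (n - a - β) ∧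
      ∀ ρ, 0 < ρ → ∫ y in ball x₀ ρ, ‖x - y‖ ^ (-a) * ‖x₀ - y‖ ^ (-β) ≤
        C * d ^ (n - a - β) * (ρ / d) ^ (n - β) := by
  obtain ⟨C₁, hC₁, h₁⟩ := exists_integral_ball_norm_rpow_le hn hβn
  obtain ⟨C₂, hC₂, h₂⟩ := exists_integral_ball_norm_rpow_le hn han
  obtain ⟨C₃, hC₃, h₃⟩ := exists_integral_compl_ball_norm_rpow_le hn haβ
  refine ⟨C₁ + C₂ + C₃ + C₃, by positivity, fun d hd x x₀ hx => ?_⟩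
  set k : Euc n → ℝ := fun y => ‖x - y‖ ^ (-a) * ‖x₀ - y‖ ^ (-β) with hk
  have hk0 : ∀ y, 0 ≤ k y := fun y => by positivity
  have hkm : Measurable k := by fun_prop
  set g₁ : Euc n → ℝ := (ball x₀ d).indicator fun y => ‖x₀ - y‖ ^ (-β) with hg₁
  set g₂ : Euc n → ℝ := (ball x d).indicator fun y => ‖x - y‖ ^ (-a) with hg₂
  set g₃ : Euc n → ℝ := (ball x₀ d)ᶜ.indicator fun y => ‖x₀ - y‖ ^ (-(a + β)) with hg₃
  set g₄ : Euc n → ℝ := (ball x d)ᶜ.indicator fun y => ‖x - y‖ ^ (-(a + β)) with hg₄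
  have i₁ : Integrable g₁ := (integrable_indicator_iff measurableSet_ball).2 (h₁ d hd x₀).1
  have i₂ : Integrable g₂ := (integrable_indicator_iff measurableSet_ball).2 (h₂ d hd x).1
  have i₃ : Integrable g₃ := (integrable_indicator_iff measurableSet_ball.compl).2 (h₃ d hd x₀).1
  have i₄ : Integrable g₄ := (integrable_indicator_iff measurableSet_ball.compl).2 (h₃ d hd x).1
  have p₁ : ∀ y, 0 ≤ g₁ y := Set.indicator_nonneg fun y _ => by positivity
  have p₂ : ∀ y, 0 ≤ g₂ y := Set.indicator_nonneg fun y _ => by positivity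
  have p₃ : ∀ y, 0 ≤ g₃ y := Set.indicator_nonneg fun y _ => by positivity
  have p₄ : ∀ y, 0 ≤ g₄ y := Set.indicator_nonneg fun y _ => by positivity
  have far : ∀ y, ‖x₀ - y‖ < d → d ≤ ‖x - y‖ := fun y hy => by
    have := norm_sub_le_norm_sub_add_norm_sub x y x₀
    rw [norm_sub_rev y x₀] at this
    linarith
  have hfar : ∀ y, ‖x₀ - y‖ < d → k y ≤ d ^ (-a) * ‖x₀ - y‖ ^ (-β) := fun y hy =>
    mul_le_mul_of_nonneg_right
      (Real.rpow_le_rpow_of_nonpos hd (far y hy) (by linarith)) (by positivity)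
  have hle : ∀ y, k y ≤ d ^ (-a) * g₁ y + d ^ (-β) * g₂ y + g₃ y + g₄ y := by
    intro y
    have q₁ : 0 ≤ d ^ (-a) * g₁ y := mul_nonneg (by positivity) (p₁ y)
    have q₂ : 0 ≤ d ^ (-β) * g₂ y := mul_nonneg (by positivity) (p₂ y)
    have := p₃ y
    have := p₄ y
    rcases lt_or_ge ‖x₀ - y‖ d with h | h
    · have hg : g₁ y = ‖x₀ - y‖ ^ (-β) := Set.indicator_of_mem (by
        rwa [mem_ball, dist_eq_norm, norm_sub_rev]) _
      have := hfar y h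
      rw [← hg] at this
      linarith
    rcases lt_or_ge ‖x - y‖ d with h' | h'
    · have hg : g₂ y = ‖x - y‖ ^ (-a) := Set.indicator_of_mem (by
        rwa [mem_ball, dist_eq_norm, norm_sub_rev]) _
      have : k y ≤ d ^ (-β) * g₂ y := by
        rw [hg, mul_comm]
        exact mul_le_mul_of_nonneg_left
          (Real.rpow_le_rpow_of_nonpos hd h (by linarith)) (by positivity)
      linarith
    have hg3 : g₃ y = ‖x₀ - y‖ ^ (-(a + β)) := Set.indicator_of_mem (by
        simpa [dist_eq_norm, norm_sub_rev] using h) _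
    have hg4 : g₄ y = ‖x - y‖ ^ (-(a + β)) := Set.indicator_of_mem (by
        simpa [dist_eq_norm, norm_sub_rev] using h') _
    have e₁ : 0 < ‖x₀ - y‖ := hd.trans_le h
    have e₂ : 0 < ‖x - y‖ := hd.trans_le h'
    have : k y ≤ g₃ y + g₄ y := by
      rw [hg3, hg4]
      rcases le_total ‖x₀ - y‖ ‖x - y‖ with hc | hc
      · have : k y ≤ ‖x₀ - y‖ ^ (-(a + β)) := by
          rw [neg_add, Real.rpow_add e₁]
          exact mul_le_mul_of_nonneg_right
            (Real.rpow_le_rpow_of_nonpos e₁ hc (by linarith)) (by positivity)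
        have : 0 ≤ ‖x - y‖ ^ (-(a + β)) := by positivity
        linarith
      · have : k y ≤ ‖x - y‖ ^ (-(a + β)) := by
          rw [neg_add, Real.rpow_add e₂]
          exact mul_le_mul_of_nonneg_left
            (Real.rpow_le_rpow_of_nonpos e₂ hc (by linarith)) (by positivity)
        have : 0 ≤ ‖x₀ - y‖ ^ (-(a + β)) := by positivity
        linarith
    linarith
  have i₁₂ : Integrable fun y => d ^ (-a) * g₁ y + d ^ (-β) * g₂ y :=
    (i₁.const_mul _).add (i₂.const_mul _)
  have i₁₂₃ : Integrable fun y => d ^ (-a) * g₁ y + d ^ (-β) * g₂ y + g₃ y := i₁₂.add i₃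
  have hB : Integrable fun y => d ^ (-a) * g₁ y + d ^ (-β) * g₂ y + g₃ y + g₄ y := i₁₂₃.add i₄
  have hki : Integrable k := hB.mono' hkm.aestronglyMeasurable <| Eventually.of_forall fun y => by
    rw [Real.norm_of_nonneg (hk0 y)]; exact hle y
  have e₁ : d ^ (-a) * d ^ (n - β) = d ^ (n - a - β) := by
    rw [← Real.rpow_add hd]; congr 1; ring
  have e₂ : d ^ (-β) * d ^ (n - a) = d ^ (n - a - β) := by
    rw [← Real.rpow_add hd]; congr 1; ring
  have e₃ : d ^ ((n : ℝ) - (a + β)) = d ^ (n - a - β) := by congr 1; ring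
  have htot : ∫ y, k y ≤ (C₁ + C₂ + C₃ + C₃) * d ^ (n - a - β) := by
    calc ∫ y, k y ≤ ∫ y, (d ^ (-a) * g₁ y + d ^ (-β) * g₂ y + g₃ y + g₄ y) :=
          integral_mono hki hB hle
      _ = d ^ (-a) * (∫ y, g₁ y) + d ^ (-β) * (∫ y, g₂ y) + (∫ y, g₃ y) + ∫ y, g₄ y := by
          rw [integral_add i₁₂₃ i₄, integral_add i₁₂ i₃,
            integral_add (i₁.const_mul _) (i₂.const_mul _), integral_const_mul,
            integral_const_mul]
      _ ≤ d ^ (-a) * (C₁ * d ^ (n - β)) + d ^ (-β) * (C₂ * d ^ (n - a)) + C₃ * d ^ (n - (a + β))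
          + C₃ * d ^ (n - (a + β)) := by
          rw [hg₁, hg₂, hg₃, hg₄, integral_indicator measurableSet_ball,
            integral_indicator measurableSet_ball, integral_indicator measurableSet_ball.compl,
            integral_indicator measurableSet_ball.compl]
          gcongr
          exacts [(h₁ d hd x₀).2, (h₂ d hd x).2, (h₃ d hd x₀).2, (h₃ d hd x).2]
      _ = _ := by rw [e₃, ← e₁]; linear_combination C₂ * (e₂ - e₁)
  refine ⟨hki, htot, fun ρ hρ => ?_⟩
  rcases le_or_gt d ρ with h | h
  · calc ∫ y in ball x₀ ρ, k y ≤ ∫ y, k y :=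
        setIntegral_le_integral hki (Eventually.of_forall hk0)
      _ ≤ _ := htot
      _ ≤ _ := le_mul_of_one_le_right (by positivity)
        (Real.one_le_rpow ((one_le_div hd).2 h) (by linarith))
  · calc ∫ y in ball x₀ ρ, k y ≤ ∫ y in ball x₀ ρ, d ^ (-a) * ‖x₀ - y‖ ^ (-β) := by
          refine setIntegral_mono_on hki.integrableOn ((h₁ ρ hρ x₀).1.const_mul _)
            measurableSet_ball fun y hy => hfar y ?_
          rw [mem_ball, dist_eq_norm, norm_sub_rev] at hy
          linarith
      _ = d ^ (-a) * ∫ y in ball x₀ ρ, ‖x₀ - y‖ ^ (-β) := integral_const_mul _ _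
      _ ≤ d ^ (-a) * (C₁ * ρ ^ (n - β)) := by gcongr; exact (h₁ ρ hρ x₀).2
      _ = C₁ * d ^ (n - a - β) * (ρ / d) ^ (n - β) := by
          rw [Real.div_rpow hρ.le hd.le, ← e₁]
          have : d ^ (n - β) ≠ 0 := by positivity
          field_simp
      _ ≤ _ := by gcongr; linarith

theorem integrableOn_norm_rpow_mul {n : ℕ} (hn : 0 < n) {b : ℝ} (hb0 : 0 ≤ b) (hb : b < n)
    {s : Set (Euc n)} (hs : MeasurableSet s) {f : Euc n → ℝ} (hf : IntegrableOn f s)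
    {x : Euc n} {r B : ℝ} (hr : 0 < r) (hB : ∀ y ∈ ball x r, y ∈ s → |f y| ≤ B) :
    IntegrableOn (fun y => ‖x - y‖ ^ (-b) * |f y|) s := by
  obtain ⟨C, -, hC⟩ := exists_integral_ball_norm_rpow_le hn hb
  have i₁ : Integrable ((ball x r).indicator fun y => ‖x - y‖ ^ (-b)) :=
    (integrable_indicator_iff measurableSet_ball).2 (hC r hr x).1
  have i₂ : IntegrableOn (fun y => |B| * (ball x r).indicator (fun y => ‖x - y‖ ^ (-b)) y
      + r ^ (-b) * |f y|) s :=
    (i₁.integrableOn.const_mul _).add (hf.abs.const_mul _)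
  have hm : Measurable fun y : Euc n => ‖x - y‖ ^ (-b) := by fun_prop
  refine i₂.mono' (hm.aestronglyMeasurable.mul hf.abs.aestronglyMeasurable) ?_
  filter_upwards [ae_restrict_mem hs] with y hy
  rw [Real.norm_of_nonneg (by positivity)]
  by_cases h : y ∈ ball x r
  · rw [Set.indicator_of_mem h, mul_comm]
    have h1 : |f y| * ‖x - y‖ ^ (-b) ≤ |B| * ‖x - y‖ ^ (-b) :=
      mul_le_mul_of_nonneg_right ((hB y h hy).trans (le_abs_self B)) (by positivity)
    have h2 : 0 ≤ r ^ (-b) * |f y| := by positivity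
    linarith
  · rw [Set.indicator_of_notMem h, mul_zero, zero_add]
    have h1 : r ≤ ‖x - y‖ := by
      rwa [mem_ball, dist_eq_norm, norm_sub_rev, not_lt] at h
    exact mul_le_mul_of_nonneg_right (Real.rpow_le_rpow_of_nonpos hr h1 (by linarith))
      (abs_nonneg _)

theorem setIntegral_indicator_ball_le {n : ℕ} {b C c : ℝ} (hc : 0 ≤ c) {s : Set (Euc n)}
    {x : Euc n} {r t : ℝ} (hi : IntegrableOn (fun y => ‖x - y‖ ^ (-b)) (ball x r))
    (hC : ∫ y in ball x r, ‖x - y‖ ^ (-b) ≤ C * t) :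
    IntegrableOn (fun y => c * (ball x r).indicator (fun y => ‖x - y‖ ^ (-b)) y) s ∧
    ∫ y in s, c * (ball x r).indicator (fun y => ‖x - y‖ ^ (-b)) y ≤ c * (C * t) := by
  have i₁ : Integrable ((ball x r).indicator fun y => ‖x - y‖ ^ (-b)) :=
    (integrable_indicator_iff measurableSet_ball).2 hi
  refine ⟨i₁.integrableOn.const_mul _, ?_⟩
  rw [integral_const_mul]
  refine mul_le_mul_of_nonneg_left (le_trans ?_ hC) hc
  rw [← integral_indicator measurableSet_ball]
  exact setIntegral_le_integral i₁ (Eventually.of_forall fun y =>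
    Set.indicator_nonneg (fun y _ => by positivity) y)

/-- Differentiation under the integral sign for weakly singular kernels. -/
theorem hasFDerivAt_setIntegral_of_singular_kernel {n : ℕ} (hn : 2 ≤ n) {s : Set (Euc n)}
    (hs : MeasurableSet s) {K : Euc n → Euc n → ℝ} {K' : Euc n → Euc n → (Euc n →L[ℝ] ℝ)}
    {f : Euc n → ℝ} {x : Euc n} {r C B : ℝ} (hr : 0 < r) (hC0 : 0 ≤ C) (hB0 : 0 ≤ B)
    (hKm : ∀ x' ∈ ball x r, AEStronglyMeasurable (K x') (volume.restrict s))
    (hKm' : AEStronglyMeasurable (K' x) (volume.restrict s))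
    (hKb : ∀ x' ∈ ball x r, ∀ y ∈ s, x' ≠ y → |K x' y| ≤ C * ‖x' - y‖ ^ (-((n : ℝ) - 2)))
    (hKb' : ∀ x' ∈ ball x r, ∀ y ∈ s, x' ≠ y → ‖K' x' y‖ ≤ C * ‖x' - y‖ ^ (-((n : ℝ) - 1)))
    (hd : ∀ x' ∈ ball x r, ∀ y ∈ s, x' ≠ y → HasFDerivAt (fun z => K z y) (K' x' y) x')
    (hf : IntegrableOn f s) (hB : ∀ y ∈ ball x r, y ∈ s → |f y| ≤ B) :
    IntegrableOn (fun y => K x y * f y) s ∧ IntegrableOn (fun y => f y • K' x y) s ∧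
      HasFDerivAt (fun x' => ∫ y in s, K x' y * f y) (∫ y in s, f y • K' x y) x := by
  have hn0 : 0 < n := by omega
  have : Nonempty (Fin n) := ⟨⟨0, hn0⟩⟩
  have hn2 : (2 : ℝ) ≤ n := by exact_mod_cast hn
  set b : ℝ := (n : ℝ) - 1 with hb
  have hbn : b < n := by linarith
  have hx : x ∈ ball x r := mem_ball_self hr
  have hne : ∀ x' : Euc n, ∀ᵐ y ∂(volume.restrict s), x' ≠ y := fun x' => by
    have : ∀ᵐ y ∂(volume : Measure (Euc n)), y ≠ x' := Measure.ae_ne volume x'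
    filter_upwards [ae_restrict_of_ae this] with y hy using hy.symm
  have hmem : ∀ᵐ y ∂(volume.restrict s), y ∈ s := ae_restrict_mem hs
  have hintg : ∀ x' ∈ ball x (r / 2), IntegrableOn (fun y => K x' y * f y) s := by
    intro x' hx'
    have hx'r : x' ∈ ball x r := ball_subset_ball (by linarith) hx'
    have := integrableOn_norm_rpow_mul hn0 (b := (n : ℝ) - 2) (by linarith) (by linarith) hs hf
      (x := x') (r := r / 2) (B := B) (by positivity) fun y hy hys => hB y (by
        rw [mem_ball] at hy hx' ⊢
        linarith [dist_triangle y x' x]) hys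
    refine (this.const_mul C).mono' ((hKm x' hx'r).mul hf.aestronglyMeasurable) ?_
    filter_upwards [hne x', hmem] with y h1 h2
    rw [norm_mul, Real.norm_eq_abs, Real.norm_eq_abs, ← mul_assoc]
    exact mul_le_mul_of_nonneg_right (hKb x' hx'r y h2 h1) (abs_nonneg _)
  have hdom : IntegrableOn (fun y => ‖x - y‖ ^ (-b) * |f y|) s :=
    integrableOn_norm_rpow_mul hn0 (by linarith) hbn hs hf hr hB
  have hintg' : IntegrableOn (fun y => f y • K' x y) s := by
    refine (hdom.const_mul C).mono' (hf.aestronglyMeasurable.smul hKm') ?_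
    filter_upwards [hne x, hmem] with y h1 h2
    rw [norm_smul, Real.norm_eq_abs, mul_comm, ← mul_assoc]
    exact mul_le_mul_of_nonneg_right (hKb' x hx y h2 h1) (abs_nonneg _)
  refine ⟨hintg x (mem_ball_self (by positivity)), hintg', ?_⟩
  rw [hasFDerivAt_iff_tendsto]
  obtain ⟨C₁, hC₁, hrad⟩ := exists_integral_ball_norm_rpow_le hn0 hbn
  set R : Euc n → Euc n → ℝ := fun x' y => K x' y - K x y - K' x y (x' - x) with hR
  set Φ : Euc n → Euc n → ℝ := fun x' => {y | 2 * ‖x' - x‖ ≤ ‖x - y‖}.indicator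
    fun y => ‖x' - x‖⁻¹ * (|R x' y| * |f y|) with hΦ
  have hΦ0 : ∀ x' y, 0 ≤ Φ x' y := fun x' y => Set.indicator_nonneg (fun y _ => by positivity) y
  have hRm : ∀ x' ∈ ball x r, AEStronglyMeasurable (R x') (volume.restrict s) := fun x' hx' =>
    ((hKm x' hx').sub (hKm x hx)).sub (hKm'.apply_continuousLinearMap (x' - x))
  have hΦm : ∀ x' ∈ ball x r, AEStronglyMeasurable (Φ x') (volume.restrict s) := fun x' hx' => by
    refine AEStronglyMeasurable.indicator ?_ (measurableSet_le measurable_const (by fun_prop))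
    exact ((hRm x' hx').norm.mul hf.aestronglyMeasurable.norm).const_mul _
  have hΦb : ∀ x' ∈ ball x (r / 4), ∀ y ∈ s, x ≠ y →
      Φ x' y ≤ C * (2 ^ b + 1) * (‖x - y‖ ^ (-b) * |f y|) := by
    intro x' hx' y hys hxy
    by_cases hy : 2 * ‖x' - x‖ ≤ ‖x - y‖
    swap
    · simp only [hΦ]
      rw [Set.indicator_of_notMem (by exact hy)]
      positivity
    simp only [hΦ]
    rw [Set.indicator_of_mem (by exact hy)]
    have hpos : 0 < ‖x - y‖ := norm_pos_iff.2 (sub_ne_zero.2 hxy)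
    rw [mem_ball_iff_norm] at hx'
    have hmv : |K x' y - K x y| ≤ C * (2 ^ b * ‖x - y‖ ^ (-b)) * ‖x' - x‖ := by
      have hseg : ∀ z ∈ closedBall x ‖x' - x‖, z ∈ ball x r ∧ ‖x - y‖ / 2 ≤ ‖z - y‖ := by
        intro z hz
        rw [mem_closedBall_iff_norm] at hz
        refine ⟨mem_ball_iff_norm.2 (by linarith), ?_⟩
        have := norm_sub_le_norm_sub_add_norm_sub x z y
        rw [norm_sub_rev x z] at this
        linarith
      refine (convex_closedBall x ‖x' - x‖).norm_image_sub_le_of_norm_hasFDerivWithin_le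
        (f := fun z => K z y) (f' := fun z => K' z y) (fun z hz => ?_) (fun z hz => ?_)
        (mem_closedBall_self (norm_nonneg _)) (mem_closedBall_iff_norm.2 le_rfl)
      · obtain ⟨h1, h2⟩ := hseg z hz
        refine (hd z h1 y hys ?_).hasFDerivWithinAt
        rintro rfl
        simp at h2
        linarith
      · obtain ⟨h1, h2⟩ := hseg z hz
        have hzy : z ≠ y := by
          rintro rfl
          simp at h2
          linarith
        refine (hKb' z h1 y hys hzy).trans (mul_le_mul_of_nonneg_left ?_ hC0)
        calc ‖z - y‖ ^ (-b) ≤ (‖x - y‖ / 2) ^ (-b) :=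
              Real.rpow_le_rpow_of_nonpos (by positivity) h2 (by linarith)
          _ = 2 ^ b * ‖x - y‖ ^ (-b) := by
              rw [Real.div_rpow hpos.le (by norm_num), Real.rpow_neg (by norm_num : (0 : ℝ) ≤ 2)]
              field_simp
    have hRb : |R x' y| ≤ ‖x' - x‖ * (C * (2 ^ b + 1) * ‖x - y‖ ^ (-b)) := by
      have h2 : |K' x y (x' - x)| ≤ C * ‖x - y‖ ^ (-b) * ‖x' - x‖ :=
        ((K' x y).le_opNorm _).trans
          (mul_le_mul_of_nonneg_right (hKb' x hx y hys hxy) (norm_nonneg _))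
      calc |R x' y| ≤ |K x' y - K x y| + |K' x y (x' - x)| := abs_sub _ _
        _ ≤ _ := add_le_add hmv h2
        _ = _ := by ring
    rcases eq_or_lt_of_le (norm_nonneg (x' - x)) with h0 | h0
    · rw [← h0, inv_zero, zero_mul]; positivity
    calc ‖x' - x‖⁻¹ * (|R x' y| * |f y|)
        ≤ ‖x' - x‖⁻¹ * (‖x' - x‖ * (C * (2 ^ b + 1) * ‖x - y‖ ^ (-b)) * |f y|) := by gcongr
      _ = _ := by field_simp
  have hlim : Tendsto (fun x' => ∫ y in s, Φ x' y) (𝓝 x) (𝓝 0) := by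
    have h0 : ∫ y in s, (fun _ => (0 : ℝ)) y = 0 := by simp
    rw [← h0]
    refine tendsto_integral_filter_of_dominated_convergence
      (fun y => C * (2 ^ b + 1) * (‖x - y‖ ^ (-b) * |f y|)) ?_ ?_ (hdom.const_mul _) ?_
    · filter_upwards [ball_mem_nhds x hr] with x' hx' using hΦm x' hx'
    · filter_upwards [ball_mem_nhds x (show 0 < r / 4 by positivity)] with x' hx'
      filter_upwards [hne x, hmem] with y h1 h2
      rw [Real.norm_of_nonneg (hΦ0 x' y)]
      exact hΦb x' hx' y h2 h1
    · filter_upwards [hne x, hmem] with y h1 h2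
      have := (hasFDerivAt_iff_tendsto.1 (hd x hx y h2 h1)).mul_const |f y|
      rw [zero_mul] at this
      refine squeeze_zero (fun x' => hΦ0 x' y) (fun x' => ?_) this
      refine (Set.indicator_le_self' (fun y _ => by positivity) y).trans (le_of_eq ?_)
      rw [mul_assoc]; rfl
  have hbound : Tendsto (fun x' => (∫ y in s, Φ x' y) + 3 * C * B * (C₁ * (2 * ‖x' - x‖))
      + 3 * C * B * (C₁ * (3 * ‖x' - x‖))) (𝓝 x) (𝓝 0) := by
    have h1 : Tendsto (fun x' : Euc n => ‖x' - x‖) (𝓝 x) (𝓝 0) := by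
      have : Continuous fun x' : Euc n => ‖x' - x‖ := by fun_prop
      simpa using this.tendsto x
    simpa using (hlim.add (((h1.const_mul 2).const_mul C₁).const_mul (3 * C * B))).add
      (((h1.const_mul 3).const_mul C₁).const_mul (3 * C * B))
  refine squeeze_zero' (Eventually.of_forall fun x' => by positivity) ?_ hbound
  filter_upwards [ball_mem_nhds x (show 0 < r / 4 by positivity)] with x' hx'
  have hx'2 : x' ∈ ball x (r / 2) := ball_subset_ball (by linarith) hx'
  have hx'r : x' ∈ ball x r := ball_subset_ball (by linarith) hx'
  have hΦn : 0 ≤ ∫ y in s, Φ x' y := integral_nonneg (hΦ0 x')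
  rcases eq_or_lt_of_le (norm_nonneg (x' - x)) with h0 | h0
  · rw [← h0, inv_zero, zero_mul]; positivity
  set δ := ‖x' - x‖ with hδ
  have hδr : δ < r / 4 := by rwa [mem_ball_iff_norm] at hx'
  have hrb : ∀ c : ℝ, 0 < c → c ^ ((n : ℝ) - b) = c := fun c _ => by
    rw [hb, sub_sub_cancel, Real.rpow_one]
  have r₂ := hrad (2 * δ) (by positivity) x
  have r₃ := hrad (3 * δ) (by positivity) x'
  rw [hrb _ (by positivity)] at r₂ r₃
  obtain ⟨j₂, k₂⟩ := setIntegral_indicator_ball_le (s := s) (c := 3 * C * B) (by positivity)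
    r₂.1 r₂.2
  obtain ⟨j₃, k₃⟩ := setIntegral_indicator_ball_le (s := s) (c := 3 * C * B) (by positivity)
    r₃.1 r₃.2
  have j₁ : IntegrableOn (Φ x') s := by
    refine (hdom.const_mul (C * (2 ^ b + 1))).mono' (hΦm x' hx'r) ?_
    filter_upwards [hne x, hmem] with y h1 h2
    rw [Real.norm_of_nonneg (hΦ0 x' y)]
    exact hΦb x' hx' y h2 h1
  have hrepr : (∫ y in s, K x' y * f y) - (∫ y in s, K x y * f y)
      - (∫ y in s, f y • K' x y) (x' - x) = ∫ y in s, R x' y * f y := by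
    have hap := ContinuousLinearMap.integral_apply hintg' (x' - x)
    have hx2 : x ∈ ball x (r / 2) := mem_ball_self (by positivity)
    have i₁ : IntegrableOn (fun y => K x' y * f y - K x y * f y) s :=
      (hintg x' hx'2).sub (hintg x hx2)
    have i₂ : IntegrableOn (fun y => (f y • K' x y) (x' - x)) s :=
      hintg'.apply_continuousLinearMap (x' - x)
    rw [hap, ← integral_sub (hintg x' hx'2) (hintg x hx2), ← integral_sub i₁ i₂]
    refine integral_congr_ae (Eventually.of_forall fun y => ?_)
    simp only [hR, smul_apply, smul_eq_mul]
    ring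
  have hpt : ∀ᵐ y ∂(volume.restrict s), δ⁻¹ * (|R x' y| * |f y|) ≤
      Φ x' y + 3 * C * B * (ball x (2 * δ)).indicator (fun y => ‖x - y‖ ^ (-b)) y
        + 3 * C * B * (ball x' (3 * δ)).indicator (fun y => ‖x' - y‖ ^ (-b)) y := by
    filter_upwards [hne x, hne x', hmem] with y h1 h2 hys
    have hi₂ : 0 ≤ 3 * C * B * (ball x (2 * δ)).indicator (fun y => ‖x - y‖ ^ (-b)) y :=
      mul_nonneg (by positivity) (Set.indicator_nonneg (fun y _ => by positivity) y)
    have hi₃ : 0 ≤ 3 * C * B * (ball x' (3 * δ)).indicator (fun y => ‖x' - y‖ ^ (-b)) y :=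
      mul_nonneg (by positivity) (Set.indicator_nonneg (fun y _ => by positivity) y)
    by_cases hy : 2 * δ ≤ ‖x - y‖
    · have : Φ x' y = δ⁻¹ * (|R x' y| * |f y|) := Set.indicator_of_mem (by exact hy) _
      linarith
    · push Not at hy
      have hΦy := hΦ0 x' y
      have hy2 : ‖x' - y‖ < 3 * δ := by
        have := norm_sub_le_norm_sub_add_norm_sub x' x y
        linarith
      rw [Set.indicator_of_mem (by rwa [mem_ball, dist_eq_norm, norm_sub_rev]),
        Set.indicator_of_mem (by rwa [mem_ball, dist_eq_norm, norm_sub_rev])]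
      have hfB : |f y| ≤ B := hB y (by
        rw [mem_ball, dist_eq_norm, norm_sub_rev]; linarith) hys
      have hp : ∀ z : Euc n, z ≠ y → ∀ c, ‖z - y‖ ≤ c →
          ‖z - y‖ ^ (-((n : ℝ) - 2)) ≤ c * ‖z - y‖ ^ (-b) := fun z hz c hc => by
        have h0 : 0 < ‖z - y‖ := norm_pos_iff.2 (sub_ne_zero.2 hz)
        rw [show -((n : ℝ) - 2) = 1 + -b by rw [hb]; ring, Real.rpow_add h0, Real.rpow_one]
        gcongr
      have q₁ : |K x' y| ≤ C * (3 * δ * ‖x' - y‖ ^ (-b)) := (hKb x' hx'r y hys h2).trans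
        (mul_le_mul_of_nonneg_left (hp x' h2 _ hy2.le) hC0)
      have q₂ : |K x y| ≤ C * (2 * δ * ‖x - y‖ ^ (-b)) := (hKb x hx y hys h1).trans
        (mul_le_mul_of_nonneg_left (hp x h1 _ hy.le) hC0)
      have q₃ : |K' x y (x' - x)| ≤ C * ‖x - y‖ ^ (-b) * δ :=
        ((K' x y).le_opNorm _).trans
          (mul_le_mul_of_nonneg_right (hKb' x hx y hys h1) (norm_nonneg _))
      have hRb : |R x' y| ≤ δ * (3 * C * ‖x - y‖ ^ (-b) + 3 * C * ‖x' - y‖ ^ (-b)) := by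
        have := (abs_sub (K x' y - K x y) (K' x y (x' - x))).trans
          (add_le_add_left (abs_sub (K x' y) (K x y)) _)
        simp only [hR]
        linarith
      have : δ⁻¹ * (|R x' y| * |f y|) ≤
          3 * C * B * ‖x - y‖ ^ (-b) + 3 * C * B * ‖x' - y‖ ^ (-b) := by
        calc δ⁻¹ * (|R x' y| * |f y|)
            ≤ δ⁻¹ * (δ * (3 * C * ‖x - y‖ ^ (-b) + 3 * C * ‖x' - y‖ ^ (-b)) * B) := by gcongr
          _ = _ := by field_simp
      linarith
  rw [hrepr]
  have j₁₂ : IntegrableOn (fun y => Φ x' y +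
      3 * C * B * (ball x (2 * δ)).indicator (fun y => ‖x - y‖ ^ (-b)) y) s := j₁.add j₂
  have j₁₂₃ : IntegrableOn (fun y => Φ x' y
      + 3 * C * B * (ball x (2 * δ)).indicator (fun y => ‖x - y‖ ^ (-b)) y
      + 3 * C * B * (ball x' (3 * δ)).indicator (fun y => ‖x' - y‖ ^ (-b)) y) s := j₁₂.add j₃
  calc δ⁻¹ * ‖∫ y in s, R x' y * f y‖ ≤ δ⁻¹ * ∫ y in s, |R x' y| * |f y| := by
        gcongr
        refine (norm_integral_le_integral_norm _).trans (le_of_eq ?_)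
        simp_rw [norm_mul, Real.norm_eq_abs]
    _ = ∫ y in s, δ⁻¹ * (|R x' y| * |f y|) := (integral_const_mul _ _).symm
    _ ≤ ∫ y in s, (Φ x' y + 3 * C * B * (ball x (2 * δ)).indicator (fun y => ‖x - y‖ ^ (-b)) y
        + 3 * C * B * (ball x' (3 * δ)).indicator (fun y => ‖x' - y‖ ^ (-b)) y) :=
      integral_mono_of_nonneg (Eventually.of_forall fun y => by positivity) j₁₂₃ hpt
    _ ≤ _ := by
        rw [integral_add j₁₂ j₃, integral_add j₁ j₂]
        gcongr

theorem cGreen_nonneg {n : ℕ} (hn : 2 ≤ n) : 0 ≤ cGreen n := by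
  have hn2 : (2 : ℝ) ≤ n := by exact_mod_cast hn
  have : 0 ≤ omegaSph n := ENNReal.toReal_nonneg
  have : 0 ≤ (n : ℝ) - 2 := by linarith
  unfold cGreen
  positivity

theorem differentiableAt_norm_sub_rpow {n : ℕ} {x y : Euc n} (hxy : x ≠ y) (a : ℝ) :
    DifferentiableAt ℝ (fun z => ‖z - y‖ ^ a) x ∧
      ‖fderiv ℝ (fun z => ‖z - y‖ ^ a) x‖ ≤ |a| * ‖x - y‖ ^ (a - 1) := by
  have h0 : x - y ≠ 0 := sub_ne_zero.2 hxy
  have hpos : 0 < ‖x - y‖ := norm_pos_iff.2 h0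
  have hd : DifferentiableAt ℝ (fun z : Euc n => ‖z - y‖) x :=
    (differentiableAt_id.sub_const y).norm ℝ h0
  have hL : LipschitzWith 1 (fun z : Euc n => ‖z - y‖) :=
    LipschitzWith.of_dist_le_mul fun z w => by
      rw [NNReal.coe_one, one_mul, Real.dist_eq, dist_eq_norm]
      refine (abs_norm_sub_norm_le _ _).trans (le_of_eq ?_)
      congr 1; abel
  have hnorm : ‖fderiv ℝ (fun z : Euc n => ‖z - y‖) x‖ ≤ 1 :=
    norm_fderiv_le_of_lipschitz ℝ hL
  have hr := hd.hasFDerivAt.rpow_const (p := a) (Or.inl hpos.ne')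
  refine ⟨hr.differentiableAt, ?_⟩
  rw [hr.fderiv, norm_smul, norm_mul, Real.norm_eq_abs, Real.norm_of_nonneg (by positivity)]
  exact mul_le_of_le_one_right (by positivity) hnorm

namespace BlowupSetup

variable {n : ℕ}

theorem abs_G_le (S : BlowupSetup n) {x y : Euc n} (hx : x ∈ S.Ω) (hy : y ∈ S.Ω) (hxy : x ≠ y) :
    |S.G x y| ≤ cGreen n * ‖x - y‖ ^ (-((n : ℝ) - 2)) := by
  rw [abs_of_pos (S.Gpos x hx y hy hxy), neg_sub]
  exact S.Gle x hx y hy hxy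

theorem abs_H_le (S : BlowupSetup n) {x y : Euc n} (hx : x ∈ S.Ω) (hy : y ∈ S.Ω) (hxy : x ≠ y) :
    |S.H x y| ≤ cGreen n * ‖x - y‖ ^ (-((n : ℝ) - 2)) := by
  have h1 := S.Gpos x hx y hy hxy
  have h2 := S.Gle x hx y hy hxy
  have h3 := S.Gdecomp x hx y hy hxy
  rw [neg_sub, abs_le]
  constructor <;> linarith

theorem exists_norm_fderiv_G_le (S : BlowupSetup n) (hn : 2 ≤ n) :
    ∃ C : ℝ, 0 ≤ C ∧ ∀ x r, 0 < r → ball x r ⊆ S.Ω → ∀ y ∈ S.Ω, x ≠ y →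
      DifferentiableAt ℝ (fun z => S.G z y) x ∧
      ‖fderiv ℝ (fun z => S.G z y) x‖ ≤
        C * (‖x - y‖ ^ (-((n : ℝ) - 1)) + r⁻¹ * ‖x - y‖ ^ (-((n : ℝ) - 2))) := by
  have hn2 : (2 : ℝ) ≤ n := by exact_mod_cast hn
  have hc := cGreen_nonneg hn
  set κ := cGreen n + 1 with hκ
  have hκ0 : 0 < κ := by linarith
  set E : ℝ := 2 * n * (n + 1) * (κ * 2 ^ ((n : ℝ) - 2)) with hE
  have hE0 : 0 ≤ E := by positivity
  refine ⟨cGreen n * n + 2 * E, by positivity, fun x r hr hball y hy hxy => ?_⟩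
  set ρ := ‖x - y‖ with hρ
  have hρ0 : 0 < ρ := norm_pos_iff.2 (sub_ne_zero.2 hxy)
  have hx : x ∈ S.Ω := hball (mem_ball_self hr)
  have hΩ : S.Ω ∈ 𝓝 x := S.hΩo.mem_nhds hx
  obtain ⟨hH2, hHl⟩ := S.Hharm y hy
  have hHd : DifferentiableAt ℝ (fun z => S.H z y) x :=
    (hH2.contDiffAt hΩ).differentiableAt (by norm_num)
  obtain ⟨hNd, hNb⟩ := differentiableAt_norm_sub_rpow hxy ((2 : ℝ) - n)
  have heq : (fun z => S.G z y) =ᶠ[𝓝 x]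
      fun z => cGreen n * ‖z - y‖ ^ ((2 : ℝ) - n) - S.H z y := by
    filter_upwards [hΩ, isOpen_ne.mem_nhds hxy] with z hz hzy using S.Gdecomp z hz y hy hzy
  have hder : HasFDerivAt (fun z => S.G z y)
      (cGreen n • fderiv ℝ (fun z => ‖z - y‖ ^ ((2 : ℝ) - n)) x - fderiv ℝ (fun z => S.H z y) x) x :=
    ((hNd.hasFDerivAt.const_mul _).sub hHd.hasFDerivAt).congr_of_eventuallyEq heq
  refine ⟨hder.differentiableAt, ?_⟩
  set s := min r (ρ / 2) with hs
  have hs0 : 0 < s := lt_min hr (by positivity)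
  have hsinv : s⁻¹ ≤ r⁻¹ + 2 * ρ⁻¹ := by
    rcases min_choice r (ρ / 2) with h | h
    · rw [hs, h]; have : 0 ≤ 2 * ρ⁻¹ := by positivity
      linarith
    · rw [hs, h, inv_div]; have : 0 ≤ r⁻¹ := by positivity
      rw [div_eq_mul_inv]; linarith
  have hM : κ * (ρ / 2) ^ (-((n : ℝ) - 2)) = κ * 2 ^ ((n : ℝ) - 2) * ρ ^ (-((n : ℝ) - 2)) := by
    rw [Real.div_rpow hρ0.le (by norm_num), Real.rpow_neg (by norm_num : (0:ℝ) ≤ 2), div_inv_eq_mul]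
    ring
  have hHb := norm_fderiv_le_of_lap_eq_zero (h := fun z => S.H z y) (x := x) (R := s)
    (M := κ * (ρ / 2) ^ (-((n : ℝ) - 2))) hs0 (by positivity)
    (hH2.mono ((ball_subset_ball (min_le_left _ _)).trans hball))
    (fun z hz => hHl z (hball (ball_subset_ball (min_le_left _ _) hz)))
    (fun z hz => by
      have hz1 : z ∈ S.Ω := hball (ball_subset_ball (min_le_left _ _) hz)
      have hz2 : ‖z - x‖ < ρ / 2 := by
        rw [mem_ball_iff_norm] at hz; exact hz.trans_le (min_le_right _ _)
      have hz3 : ρ / 2 ≤ ‖z - y‖ := by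
        have := norm_sub_le_norm_sub_add_norm_sub x z y
        rw [norm_sub_rev x z] at this
        linarith
      have hzy : z ≠ y := by
        rintro rfl; simp at hz3; linarith
      refine (S.abs_H_le hz1 hy hzy).trans ?_
      have : ‖z - y‖ ^ (-((n : ℝ) - 2)) ≤ (ρ / 2) ^ (-((n : ℝ) - 2)) :=
        Real.rpow_le_rpow_of_nonpos (by positivity) hz3 (by linarith)
      exact mul_le_mul (by linarith) this (by positivity) hκ0.le)
  rw [hM] at hHb
  have hsp : ρ ^ (-((n : ℝ) - 1)) = ρ⁻¹ * ρ ^ (-((n : ℝ) - 2)) := by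
    rw [← Real.rpow_neg_one, ← Real.rpow_add hρ0]; congr 1; ring
  have hNb' : ‖fderiv ℝ (fun z => ‖z - y‖ ^ ((2 : ℝ) - n)) x‖ ≤ n * ρ ^ (-((n : ℝ) - 1)) := by
    refine hNb.trans ?_
    rw [show (2 : ℝ) - n - 1 = -((n : ℝ) - 1) by ring]
    have : |(2 : ℝ) - n| ≤ n := by rw [abs_le]; constructor <;> linarith
    gcongr
  have hHb' : ‖fderiv ℝ (fun z => S.H z y) x‖ ≤
      E * (ρ ^ (-((n : ℝ) - 2)) * (r⁻¹ + 2 * ρ⁻¹)) := by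
    refine hHb.trans ?_
    calc _ = E * (ρ ^ (-((n : ℝ) - 2)) * s⁻¹) := by rw [hE]; ring
      _ ≤ _ := by gcongr
  rw [hder.fderiv]
  refine (norm_sub_le _ _).trans ?_
  rw [norm_smul, Real.norm_of_nonneg hc]
  set X := ρ ^ (-((n : ℝ) - 2))
  have hX : 0 ≤ X := by positivity
  have e1 : cGreen n * ‖fderiv ℝ (fun z => ‖z - y‖ ^ ((2 : ℝ) - n)) x‖ ≤
      cGreen n * (n * (ρ⁻¹ * X)) := by rw [← hsp]; gcongr
  rw [hsp]
  have : 0 ≤ (cGreen n * n) * (r⁻¹ * X) := by positivity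
  have : 0 ≤ E * (r⁻¹ * X) := by positivity
  nlinarith

/-- Measurability of the Green-type kernel in its second variable. -/
theorem aestronglyMeasurable_G (S : BlowupSetup n) (hn : 1 ≤ n) {x : Euc n} (hx : x ∈ S.Ω) :
    AEStronglyMeasurable (S.G x) (volume.restrict S.Ω) := by
  have : Nonempty (Fin n) := ⟨⟨0, hn⟩⟩
  have hm := S.hΩo.measurableSet
  have h1 : AEStronglyMeasurable (fun y => S.H y x) (volume.restrict S.Ω) :=
    (S.Hharm x hx).1.continuousOn.aestronglyMeasurable hm
  have h2 : Measurable fun y : Euc n => cGreen n * ‖y - x‖ ^ ((2 : ℝ) - n) := by fun_prop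
  refine (h2.aestronglyMeasurable.sub h1).congr ?_
  filter_upwards [ae_restrict_mem hm, ae_restrict_of_ae (Measure.ae_ne volume x)] with y hy hyx
  rw [S.Gsymm x y]
  exact (S.Gdecomp y hy x hx hyx).symm

theorem aestronglyMeasurable_fderiv_G (S : BlowupSetup n) (hn : 2 ≤ n) {x : Euc n}
    (hx : x ∈ S.Ω) :
    AEStronglyMeasurable (fun y => fderiv ℝ (fun z => S.G z y) x) (volume.restrict S.Ω) := by
  have : Nonempty (Fin n) := ⟨⟨0, by omega⟩⟩
  have hm := S.hΩo.measurableSet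
  obtain ⟨r, hr, hball⟩ := Metric.isOpen_iff.1 S.hΩo x hx
  obtain ⟨C, -, hC⟩ := S.exists_norm_fderiv_G_le hn
  have hcomp : ∀ i : Fin n, AEStronglyMeasurable
      (fun y => fderiv ℝ (fun z => S.G z y) x (EuclideanSpace.single i 1))
      (volume.restrict S.Ω) := by
    intro i
    set e : Euc n := EuclideanSpace.single i 1
    have he : ‖e‖ = 1 := by simp [e]
    obtain ⟨m₀, hm₀⟩ := exists_nat_gt r⁻¹
    have hm₀' : 0 < (m₀ : ℝ) := (by positivity : (0:ℝ) < r⁻¹).trans hm₀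
    set c : ℕ → ℝ := fun m => (m + m₀ : ℝ)
    have hc0 : ∀ m, 0 < c m := fun m => by positivity
    have hct : Tendsto c atTop atTop :=
      tendsto_atTop_add_const_right _ _ tendsto_natCast_atTop_atTop
    refine aestronglyMeasurable_of_tendsto_ae atTop
      (f := fun m y => c m * (S.G (x + (c m)⁻¹ • e) y - S.G x y)) (fun m => ?_) ?_
    · refine ((S.aestronglyMeasurable_G (by omega) (hball ?_)).sub
        (S.aestronglyMeasurable_G (by omega) hx)).const_mul _
      rw [mem_ball_iff_norm, add_sub_cancel_left, norm_smul, he, mul_one,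
        Real.norm_of_nonneg (by have := hc0 m; positivity)]
      refine inv_lt_of_inv_lt₀ hr (hm₀.trans_le ?_)
      simp [c]
    · filter_upwards [ae_restrict_mem hm, ae_restrict_of_ae (Measure.ae_ne volume x)] with y hy hyx
      have := (hC x r hr hball y hy hyx.symm).1.hasFDerivAt
      have := this.lim_real e
      exact this.comp hct
  have hrec : (fun y => fderiv ℝ (fun z => S.G z y) x) = fun y => ∑ i : Fin n,
      (fderiv ℝ (fun z => S.G z y) x (EuclideanSpace.single i 1)) •
        (EuclideanSpace.proj i : Euc n →L[ℝ] ℝ) := by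
    funext y
    ext z
    conv_lhs => rw [← (EuclideanSpace.basisFun (Fin n) ℝ).sum_repr z]
    simp [mul_comm]
  rw [hrec]
  exact Finset.aestronglyMeasurable_fun_sum _ fun i _ => (hcomp i).smul_const _

/-- The Green-type potential of an integrable density is differentiable wherever the density is
locally bounded, and may be differentiated under the integral sign. -/
theorem hasFDerivAt_potential (S : BlowupSetup n) (hn : 2 ≤ n) {x : Euc n} (hx : x ∈ S.Ω)
    {f : Euc n → ℝ} (hf : IntegrableOn f S.Ω) {t B : ℝ} (ht : 0 < t)
    (hB : ∀ y ∈ ball x t, y ∈ S.Ω → |f y| ≤ B) :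
    IntegrableOn (fun y => S.G x y * f y) S.Ω ∧
      IntegrableOn (fun y => f y • fderiv ℝ (fun z => S.G z y) x) S.Ω ∧
      HasFDerivAt (fun x' => ∫ y in S.Ω, S.G x' y * f y)
        (∫ y in S.Ω, f y • fderiv ℝ (fun z => S.G z y) x) x := by
  have hc := cGreen_nonneg hn
  obtain ⟨r, hr, hball⟩ := Metric.isOpen_iff.1 S.hΩo x hx
  obtain ⟨C, hC0, hC⟩ := S.exists_norm_fderiv_G_le hn
  obtain ⟨D, hD⟩ := S.hΩb.exists_norm_le
  have hD0 : 0 ≤ D := (norm_nonneg x).trans (hD x hx)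
  set ρ := min t (r / 2) with hρ
  have hρ0 : 0 < ρ := lt_min ht (by positivity)
  have hsub : ∀ x' ∈ ball x ρ, ball x' (r / 2) ⊆ S.Ω := fun x' hx' z hz => hball (by
    have := ball_subset_ball (min_le_right t (r / 2)) hx'
    rw [mem_ball] at *
    linarith [dist_triangle z x' x])
  have hin : ∀ x' ∈ ball x ρ, x' ∈ S.Ω := fun x' hx' => hsub x' hx' (mem_ball_self (by positivity))
  set C' := cGreen n + C * (1 + (r / 2)⁻¹ * (2 * D)) with hC'
  have hCD : 0 ≤ C * (1 + (r / 2)⁻¹ * (2 * D)) := by positivity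
  refine hasFDerivAt_setIntegral_of_singular_kernel hn S.hΩo.measurableSet hρ0
    (K := S.G) (K' := fun x' y => fderiv ℝ (fun z => S.G z y) x') (C := C') (B := max B 0)
    (by positivity) (le_max_right _ _)
    (fun x' hx' => S.aestronglyMeasurable_G (by omega) (hin x' hx'))
    (S.aestronglyMeasurable_fderiv_G hn hx) (fun x' hx' y hy hne => ?_)
    (fun x' hx' y hy hne => ?_)
    (fun x' hx' y hy hne => (hC x' (r / 2) (by positivity) (hsub x' hx') y hy hne).1.hasFDerivAt)
    hf (fun y hy hys => (hB y (ball_subset_ball (min_le_left _ _) hy) hys).trans (le_max_left _ _))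
  · refine (S.abs_G_le (hin x' hx') hy hne).trans ?_
    gcongr
    linarith
  · refine (hC x' (r / 2) (by positivity) (hsub x' hx') y hy hne).2.trans ?_
    have h0 : 0 < ‖x' - y‖ := norm_pos_iff.2 (sub_ne_zero.2 hne)
    have hle : ‖x' - y‖ ≤ 2 * D := by
      linarith [norm_sub_le x' y, hD x' (hin x' hx'), hD y hy]
    have hsp : ‖x' - y‖ ^ (-((n : ℝ) - 2)) = ‖x' - y‖ * ‖x' - y‖ ^ (-((n : ℝ) - 1)) := by
      rw [show -((n : ℝ) - 2) = 1 + -((n : ℝ) - 1) by ring, Real.rpow_add h0, Real.rpow_one]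
    rw [hsp]
    set X := ‖x' - y‖ ^ (-((n : ℝ) - 1))
    have hX : 0 ≤ X := by positivity
    calc C * (X + (r / 2)⁻¹ * (‖x' - y‖ * X)) ≤ C * (X + (r / 2)⁻¹ * (2 * D * X)) := by gcongr
      _ = C * (1 + (r / 2)⁻¹ * (2 * D)) * X := by ring
      _ ≤ C' * X := by gcongr; linarith

end BlowupSetup

theorem exists_setIntegral_two_point_kernel_le {n : ℕ} (hn : 0 < n) {a β : ℝ}
    (han : a < n) (hβn : β < n) (haβ : (n : ℝ) < a + β) :
    ∃ C : ℝ, 0 ≤ C ∧ ∀ (d : ℝ), 0 < d → ∀ x x₀ : Euc n, ‖x - x₀‖ = 2 * d →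
      ∀ τ ρ : ℝ, 0 ≤ τ → 0 < ρ → ∀ s : Set (Euc n),
      IntegrableOn (fun y => ‖x - y‖ ^ (-a) *
        ((τ + (ball x₀ ρ).indicator (fun _ => 1) y) * ‖x₀ - y‖ ^ (-β))) s ∧
      ∫ y in s, ‖x - y‖ ^ (-a) *
        ((τ + (ball x₀ ρ).indicator (fun _ => 1) y) * ‖x₀ - y‖ ^ (-β)) ≤
        C * d ^ (n - a - β) * (τ + (ρ / d) ^ (n - β)) := by
  obtain ⟨C, hC0, hC⟩ := exists_integral_two_point_kernel_le hn han hβn haβ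
  refine ⟨C, hC0, fun d hd x x₀ hx τ ρ hτ hρ s => ?_⟩
  obtain ⟨h1, h2, h3⟩ := hC d hd x x₀ hx
  set k : Euc n → ℝ := fun y => ‖x - y‖ ^ (-a) * ‖x₀ - y‖ ^ (-β) with hk
  have hk0 : ∀ y, 0 ≤ k y := fun y => by positivity
  have heq : (fun y => ‖x - y‖ ^ (-a) *
      ((τ + (ball x₀ ρ).indicator (fun _ => 1) y) * ‖x₀ - y‖ ^ (-β))) =
      fun y => τ * k y + (ball x₀ ρ).indicator k y := by
    funext y
    by_cases hy : y ∈ ball x₀ ρ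
    · simp only [Set.indicator_of_mem hy, hk]; ring
    · simp only [Set.indicator_of_notMem hy, hk]; ring
  have i₁ : Integrable (fun y => τ * k y) := h1.const_mul τ
  have i₂ : Integrable ((ball x₀ ρ).indicator k) := h1.indicator measurableSet_ball
  have i : Integrable (fun y => τ * k y + (ball x₀ ρ).indicator k y) := i₁.add i₂
  rw [heq]
  refine ⟨i.integrableOn, (setIntegral_le_integral i (Eventually.of_forall fun y =>
    add_nonneg (mul_nonneg hτ (hk0 y)) (Set.indicator_nonneg (fun y _ => hk0 y) y))).trans ?_⟩
  rw [integral_add i₁ i₂, integral_const_mul, integral_indicator measurableSet_ball]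
  have := mul_le_mul_of_nonneg_left h2 hτ
  have := h3 ρ hρ
  linarith

theorem abs_rpow_sub_rpow_le {p M V W : ℝ} (hp : 1 ≤ p) (hV : 0 ≤ V) (hVM : V ≤ M) (hW : 0 ≤ W)
    (hWM : W ≤ M) : |V ^ p - W ^ p| ≤ p * M ^ (p - 1) * |V - W| := by
  refine Convex.norm_image_sub_le_of_norm_hasDerivWithin_le (s := Set.Icc 0 M)
    (f := fun t => t ^ p) (f' := fun t => p * t ^ (p - 1)) (fun t _ =>
      (Real.hasDerivAt_rpow_const (Or.inr hp)).hasDerivWithinAt) (fun t ht => ?_)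
    (convex_Icc 0 M) ⟨hW, hWM⟩ ⟨hV, hVM⟩
  have ht0 := ht.1
  rw [Real.norm_of_nonneg (by positivity)]
  have := Real.rpow_le_rpow ht0 ht.2 (show 0 ≤ p - 1 by linarith)
  gcongr

namespace BlowupSetup

variable {n : ℕ}

theorem d_pos (S : BlowupSetup n) (hn : 1 ≤ n) (k : ℕ) : 0 < S.d k := by
  have : Nonempty (Fin n) := ⟨⟨0, hn⟩⟩
  have hne : S.Ω ≠ Set.univ := fun h => NormedSpace.unbounded_univ ℝ (Euc n) (h ▸ S.hΩb)
  have hfr : (frontier S.Ω).Nonempty := nonempty_frontier_iff.2 ⟨⟨_, S.hxk k⟩, hne⟩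
  have hx : S.xk k ∉ frontier S.Ω := fun h => by
    have := S.hΩo.inter_frontier_eq
    exact (this ▸ ⟨S.hxk k, h⟩ : S.xk k ∈ (∅ : Set (Euc n)))
  have := (isClosed_frontier.notMem_iff_infDist_pos hfr).1 hx
  unfold d
  positivity

theorem ball_xk_subset (S : BlowupSetup n) (hn : 1 ≤ n) (k : ℕ) :
    ball (S.xk k) (4 * S.d k) ⊆ S.Ω := by
  have : Nonempty (Fin n) := ⟨⟨0, hn⟩⟩
  have hne : S.Ω ≠ Set.univ := fun h => NormedSpace.unbounded_univ ℝ (Euc n) (h ▸ S.hΩb)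
  obtain ⟨y, hy, hxy⟩ := exists_mem_frontier_infDist_compl_eq_dist (S.hxk k) hne
  refine (ball_subset_ball ?_).trans (ball_infDist_compl_subset (x := S.xk k))
  rw [hxy, d, mul_div_cancel₀ _ (by norm_num)]
  exact infDist_le_dist_of_mem hy

theorem lam_pos (S : BlowupSetup n) (k : ℕ) : 0 < S.lam k := by
  rw [S.hlam_eq k]
  exact lt_max_of_lt_left (Real.rpow_pos_of_pos (S.hv_pos k _ (S.hxk k)) _)

theorem N_pos (S : BlowupSetup n) (hn : 1 ≤ n) (k : ℕ) : 0 < S.N k :=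
  mul_pos (S.lam_pos k) (S.d_pos hn k)

/-- Potentials of densities that are small relative to `|y - x₀|^{-β}` away from a small ball
are small at distance `2d` from `x₀`. -/
theorem exists_norm_potential_le (S : BlowupSetup n) (hn : 3 ≤ n) {β : ℝ} (hβn : β < n)
    (hβ2 : 2 < β) :
    ∃ C : ℝ, 0 ≤ C ∧ ∀ d : ℝ, 0 < d → ∀ x x₀ : Euc n, ‖x - x₀‖ = 2 * d → ball x (2 * d) ⊆ S.Ω →
      ∀ M τ ρ : ℝ, 0 ≤ M → 0 ≤ τ → 0 < ρ → ∀ g : Euc n → ℝ,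
      (∀ y ∈ S.Ω, y ≠ x₀ →
        |g y| ≤ M * ((τ + (ball x₀ ρ).indicator (fun _ => 1) y) * ‖x₀ - y‖ ^ (-β))) →
      |∫ y in S.Ω, S.G x y * g y| ≤ C * d ^ (2 - β) * (M * (τ + (ρ / d) ^ (n - β))) ∧
      ‖∫ y in S.Ω, g y • fderiv ℝ (fun z => S.G z y) x‖ ≤
        C * d ^ (1 - β) * (M * (τ + (ρ / d) ^ (n - β))) := by
  have hn0 : 0 < n := by omega
  have : Nonempty (Fin n) := ⟨⟨0, hn0⟩⟩
  have hn3 : (3 : ℝ) ≤ n := by exact_mod_cast hn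
  have hc := cGreen_nonneg (n := n) (by omega)
  obtain ⟨K, hK0, hK⟩ := S.exists_norm_fderiv_G_le (by omega)
  obtain ⟨C₁, hC₁, h₁⟩ := exists_setIntegral_two_point_kernel_le hn0 (a := (n : ℝ) - 1) (β := β)
    (by linarith) hβn (by linarith)
  obtain ⟨C₂, hC₂, h₂⟩ := exists_setIntegral_two_point_kernel_le hn0 (a := (n : ℝ) - 2) (β := β)
    (by linarith) hβn (by linarith)
  refine ⟨cGreen n * C₂ + K * (C₁ + C₂), by positivity,
    fun d hd x x₀ hx hball M τ ρ hM hτ hρ g hg => ?_⟩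
  obtain ⟨i₁, b₁⟩ := h₁ d hd x x₀ hx τ ρ hτ hρ S.Ω
  obtain ⟨i₂, b₂⟩ := h₂ d hd x x₀ hx τ ρ hτ hρ S.Ω
  have hxΩ : x ∈ S.Ω := hball (mem_ball_self (by positivity))
  have hae : ∀ᵐ y ∂(volume.restrict S.Ω), y ∈ S.Ω ∧ y ≠ x ∧ y ≠ x₀ := by
    filter_upwards [ae_restrict_mem S.hΩo.measurableSet,
      ae_restrict_of_ae (Measure.ae_ne volume x), ae_restrict_of_ae (Measure.ae_ne volume x₀)]
      with y h1 h2 h3 using ⟨h1, h2, h3⟩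
  set T := τ + (ρ / d) ^ (n - β) with hT
  have hT0 : 0 ≤ T := by positivity
  set ψ : Euc n → ℝ := fun y =>
    (τ + (ball x₀ ρ).indicator (fun _ => 1) y) * ‖x₀ - y‖ ^ (-β) with hψ
  have e₁ : (n : ℝ) - (n - 1) - β = 1 - β := by ring
  have e₂ : (n : ℝ) - (n - 2) - β = 2 - β := by ring
  rw [e₁] at b₁
  rw [e₂] at b₂
  constructor
  · rw [← Real.norm_eq_abs]
    refine (norm_integral_le_of_norm_le (i₂.const_mul (cGreen n * M)) ?_).trans ?_
    · filter_upwards [hae] with y ⟨hy, hyx, hyx₀⟩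
      rw [norm_mul, Real.norm_eq_abs, Real.norm_eq_abs]
      refine (mul_le_mul (S.abs_G_le hxΩ hy hyx.symm) (hg y hy hyx₀) (abs_nonneg _)
        (by positivity)).trans (le_of_eq ?_)
      ring
    · rw [integral_const_mul]
      calc _ ≤ cGreen n * M * (C₂ * d ^ (2 - β) * T) := by gcongr
        _ = cGreen n * C₂ * d ^ (2 - β) * (M * T) := by ring
        _ ≤ _ := by
          gcongr
          have : 0 ≤ K * (C₁ + C₂) := by positivity
          linarith
  · have j₁ : IntegrableOn (fun y => K * M * (‖x - y‖ ^ (-((n : ℝ) - 1)) * ψ y)) S.Ω :=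
      i₁.const_mul _
    have j₂ : IntegrableOn (fun y => K * M * (2 * d)⁻¹ * (‖x - y‖ ^ (-((n : ℝ) - 2)) * ψ y)) S.Ω :=
      i₂.const_mul _
    have j : IntegrableOn (fun y => K * M * (‖x - y‖ ^ (-((n : ℝ) - 1)) * ψ y) +
      K * M * (2 * d)⁻¹ * (‖x - y‖ ^ (-((n : ℝ) - 2)) * ψ y)) S.Ω := j₁.add j₂
    refine (norm_integral_le_of_norm_le j ?_).trans ?_
    · filter_upwards [hae] with y ⟨hy, hyx, hyx₀⟩
      rw [norm_smul, Real.norm_eq_abs]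
      have hψ0 : 0 ≤ M * ψ y := (abs_nonneg _).trans (hg y hy hyx₀)
      have := mul_le_mul (hg y hy hyx₀)
        (hK x (2 * d) (by positivity) hball y hy hyx.symm).2 (norm_nonneg _) hψ0
      refine this.trans (le_of_eq ?_)
      simp only [hψ]
      ring
    · rw [integral_add j₁ j₂, integral_const_mul, integral_const_mul]
      have hd2 : d ^ (2 - β) = d * d ^ (1 - β) := by
        rw [show 2 - β = 1 + (1 - β) by ring, Real.rpow_add hd, Real.rpow_one]
      rw [hd2] at b₂
      calc _ ≤ K * M * (C₁ * d ^ (1 - β) * T) + K * M * (2 * d)⁻¹ * (C₂ * (d * d ^ (1 - β)) * T) := by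
            gcongr
        _ = K * (C₁ + C₂ / 2) * d ^ (1 - β) * (M * T) := by field_simp
        _ ≤ _ := by
          gcongr
          have : 0 ≤ cGreen n * C₂ := by positivity
          have : 0 ≤ K * C₂ := by positivity
          linarith

theorem integrableOn_v_rpow (S : BlowupSetup n) (k : ℕ) {B : ℝ} (hB : ∀ y ∈ S.Ω, S.v k y ≤ B) :
    IntegrableOn (fun y => S.v k y ^ S.p) S.Ω ∧ ∀ y ∈ S.Ω, |S.v k y ^ S.p| ≤ B ^ S.p := by
  have hp0 : 0 ≤ S.p := zero_le_one.trans S.hp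
  have hb : ∀ y ∈ S.Ω, |S.v k y ^ S.p| ≤ B ^ S.p := fun y hy => by
    have h0 := (S.hv_pos k y hy).le
    rw [abs_of_nonneg (by positivity)]
    exact Real.rpow_le_rpow h0 (hB y hy) hp0
  have hm := S.hΩo.measurableSet
  have : IsFiniteMeasure (volume.restrict S.Ω) := ⟨by simpa using S.hΩb.measure_lt_top⟩
  exact ⟨Integrable.of_bound (((S.hv_cont k).rpow_const fun y _ => Or.inr hp0).aestronglyMeasurable
    hm) _ ((ae_restrict_mem hm).mono hb), hb⟩

theorem abs_G_rpow_le (S : BlowupSetup n) (hn : 2 ≤ n) {x₀ y : Euc n} (hx : x₀ ∈ S.Ω)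
    (hy : y ∈ S.Ω) (hne : y ≠ x₀) :
    |S.G y x₀ ^ S.p| ≤ cGreen n ^ S.p * ‖x₀ - y‖ ^ (-(((n : ℝ) - 2) * S.p)) := by
  have hp0 : 0 ≤ S.p := zero_le_one.trans S.hp
  have h := S.abs_G_le hy hx hne
  have hG := (S.Gpos y hy x₀ hx hne).le
  have hc := cGreen_nonneg hn
  rw [abs_of_nonneg hG] at h
  rw [abs_of_nonneg (by positivity), norm_sub_rev x₀ y]
  refine (Real.rpow_le_rpow hG h hp0).trans (le_of_eq ?_)
  rw [Real.mul_rpow hc (by positivity), ← Real.rpow_mul (norm_nonneg _), neg_mul]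

theorem integrableOn_G_rpow (S : BlowupSetup n) (hn : 2 ≤ n) (hβ : ((n : ℝ) - 2) * S.p < n)
    {x₀ : Euc n} (hx : x₀ ∈ S.Ω) : IntegrableOn (fun y => S.G y x₀ ^ S.p) S.Ω := by
  have : Nonempty (Fin n) := ⟨⟨0, by omega⟩⟩
  obtain ⟨C, -, hI⟩ := exists_integral_ball_norm_rpow_le (n := n) (by omega) hβ
  obtain ⟨R, hR, hsub⟩ := S.hΩb.subset_ball_lt 0 x₀
  have hm := S.hΩo.measurableSet
  have hG : AEStronglyMeasurable (fun y => S.G y x₀) (volume.restrict S.Ω) := by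
    simpa only [S.Gsymm _ x₀] using S.aestronglyMeasurable_G (by omega) hx
  refine (((hI R hR x₀).1.mono_set hsub).const_mul (cGreen n ^ S.p)).mono'
    (hG.aemeasurable.pow_const _).aestronglyMeasurable ?_
  filter_upwards [ae_restrict_mem hm, ae_restrict_of_ae (Measure.ae_ne volume x₀)] with y hy hne
  exact S.abs_G_rpow_le hn hx hy hne

end BlowupSetup

theorem exists_forall_le_of_tendsto {a : ℕ → ℝ} {l : ℝ} (h : Tendsto a atTop (𝓝 l)) :
    ∃ M : ℝ, 0 ≤ M ∧ ∀ k, a k ≤ M := by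
  obtain ⟨M, hM⟩ := h.bddAbove_range
  exact ⟨max M 0, le_max_right _ _, fun k => (hM ⟨k, rfl⟩).trans (le_max_left _ _)⟩

namespace BlowupSetup

variable {n : ℕ}

theorem exists_rescaled_v_le (S : BlowupSetup n) (hn : 2 ≤ n) {C₀ : ℝ} (hC₀ : 0 < C₀)
    (hvbd : ∀ k, ∀ y ∈ S.Ω,
      S.v k y ≤ C₀ * S.lam k ^ ((n : ℝ) / (S.p + 1))
        * (1 + S.lam k * ‖y - S.xk k‖) ^ ((2 : ℝ) - n)) :
    ∃ C : ℝ, 0 ≤ C ∧ ∀ k, ∀ y ∈ S.Ω, y ≠ S.xk k →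
      S.lam k ^ ((n : ℝ) / (S.qk k + 1)) * S.v k y ≤ C * ‖y - S.xk k‖ ^ (-((n : ℝ) - 2)) := by
  have hn2 : (2 : ℝ) ≤ n := by exact_mod_cast hn
  obtain ⟨D, hD⟩ := S.hlam_eps
  have hD0 : 0 ≤ D := (Real.rpow_nonneg (S.lam_pos 0).le _).trans (hD 0)
  refine ⟨C₀ * D ^ (n : ℝ), by positivity, fun k y hy hne => ?_⟩
  have hl := S.lam_pos k
  set r := ‖y - S.xk k‖
  have hr : 0 < r := norm_pos_iff.2 (sub_ne_zero.2 hne)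
  have h1 : (1 + S.lam k * r) ^ ((2 : ℝ) - n) ≤ (S.lam k * r) ^ ((2 : ℝ) - n) :=
    Real.rpow_le_rpow_of_nonpos (by positivity) (by linarith) (by linarith)
  have hexp : (n : ℝ) / (S.qk k + 1) + n / (S.p + 1) + (2 - n) = S.eps k * n := by
    have := S.hqk_eq k
    have hn0 : (n : ℝ) ≠ 0 := by positivity
    rw [← sub_eq_iff_eq_add'] at this
    rw [← this]
    field_simp
    ring
  have hle : S.lam k ^ (S.eps k * n) ≤ D ^ (n : ℝ) := by
    rw [Real.rpow_mul hl.le]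
    exact Real.rpow_le_rpow (by positivity) (hD k) (by positivity)
  calc S.lam k ^ ((n : ℝ) / (S.qk k + 1)) * S.v k y
      ≤ S.lam k ^ ((n : ℝ) / (S.qk k + 1)) *
        (C₀ * S.lam k ^ ((n : ℝ) / (S.p + 1)) * (S.lam k * r) ^ ((2 : ℝ) - n)) := by
        gcongr
        exact (hvbd k y hy).trans (by gcongr)
    _ = C₀ * (S.lam k ^ ((n : ℝ) / (S.qk k + 1)) * S.lam k ^ ((n : ℝ) / (S.p + 1)) *
          S.lam k ^ ((2 : ℝ) - n)) * r ^ ((2 : ℝ) - n) := by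
        rw [Real.mul_rpow hl.le hr.le]; ring
    _ = C₀ * S.lam k ^ (S.eps k * n) * r ^ (-((n : ℝ) - 2)) := by
        rw [← Real.rpow_add hl, ← Real.rpow_add hl, hexp, neg_sub]
    _ ≤ _ := by gcongr

/-- The rescaled densities `v_k^p` are close to the limiting density `(A_k G(·, x_k))^p`. -/
theorem exists_density_sub_le (S : BlowupSetup n) (hn : 2 ≤ n) {C₀ δ A : ℝ} (hC₀ : 0 < C₀)
    (hvbd : ∀ k, ∀ y ∈ S.Ω,
      S.v k y ≤ C₀ * S.lam k ^ ((n : ℝ) / (S.p + 1))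
        * (1 + S.lam k * ‖y - S.xk k‖) ^ ((2 : ℝ) - n))
    {Ak : ℕ → ℝ} (hAk_pos : ∀ k, 0 < Ak k) (hAk : Tendsto Ak atTop (𝓝 A))
    (hvest : ∀ k, ∀ y ∈ S.Ω, 2 * S.d k / Real.sqrt (S.N k) ≤ ‖y - S.xk k‖ →
      |S.lam k ^ ((n : ℝ) / (S.qk k + 1)) * S.v k y - Ak k * S.G y (S.xk k)|
        ≤ C₀ * S.N k ^ (-δ) * ‖y - S.xk k‖ ^ (-((n : ℝ) - 2))) :
    ∃ C : ℝ, 0 ≤ C ∧ ∀ k, ∀ y ∈ S.Ω, y ≠ S.xk k →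
      |S.lam k ^ ((n : ℝ) * S.p / (S.qk k + 1)) * S.v k y ^ S.p
          - Ak k ^ S.p * S.G y (S.xk k) ^ S.p| ≤
        C * ((S.N k ^ (-δ) + (ball (S.xk k) (2 * S.d k / Real.sqrt (S.N k))).indicator
          (fun _ => 1) y) * ‖S.xk k - y‖ ^ (-(((n : ℝ) - 2) * S.p))) := by
  have hp := S.hp
  have hp0 : 0 ≤ S.p := by linarith
  have hc := cGreen_nonneg hn
  obtain ⟨C₁, hC₁, h₁⟩ := S.exists_rescaled_v_le hn hC₀ hvbd
  obtain ⟨A', hA', hAA'⟩ := exists_forall_le_of_tendsto hAk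
  set M := C₁ + A' * cGreen n with hM
  have hM0 : 0 ≤ M := by positivity
  refine ⟨M ^ S.p + S.p * M ^ (S.p - 1) * C₀, by positivity, fun k y hy hne => ?_⟩
  have hl := S.lam_pos k
  have hN := S.N_pos (by omega) k
  have hr : 0 < ‖y - S.xk k‖ := norm_pos_iff.2 (sub_ne_zero.2 hne)
  have hG := (S.Gpos y hy _ (S.hxk k) hne).le
  have hA := (hAk_pos k).le
  have hv := (S.hv_pos k y hy).le
  set X := ‖y - S.xk k‖ ^ (-((n : ℝ) - 2)) with hX
  have hX0 : 0 < X := by positivity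
  set V := S.lam k ^ ((n : ℝ) / (S.qk k + 1)) * S.v k y with hV
  set W := Ak k * S.G y (S.xk k) with hW
  have hV0 : 0 ≤ V := by positivity
  have hW0 : 0 ≤ W := by positivity
  have hVM : V ≤ M * X := (h₁ k y hy hne).trans (by gcongr; rw [hM]; nlinarith)
  have hWM : W ≤ M * X := by
    have h := S.abs_G_le hy (S.hxk k) hne
    rw [abs_of_nonneg hG] at h
    calc W ≤ A' * (cGreen n * X) := mul_le_mul (hAA' k) h hG hA'
      _ = A' * cGreen n * X := by ring
      _ ≤ M * X := by gcongr; linarith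
  have hXp : ‖S.xk k - y‖ ^ (-(((n : ℝ) - 2) * S.p)) = X ^ S.p := by
    rw [norm_sub_rev, hX, ← Real.rpow_mul hr.le, neg_mul]
  have hLHS : S.lam k ^ ((n : ℝ) * S.p / (S.qk k + 1)) * S.v k y ^ S.p
      - Ak k ^ S.p * S.G y (S.xk k) ^ S.p = V ^ S.p - W ^ S.p := by
    rw [hV, hW, Real.mul_rpow (by positivity) hv, Real.mul_rpow hA hG, ← Real.rpow_mul hl.le,
      div_mul_eq_mul_div]
  rw [hLHS, hXp]
  have hE0 : 0 ≤ S.p * M ^ (S.p - 1) * C₀ := by positivity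
  by_cases hin : y ∈ ball (S.xk k) (2 * S.d k / Real.sqrt (S.N k))
  · rw [Set.indicator_of_mem hin]
    have hVp := Real.rpow_le_rpow hV0 hVM hp0
    have hWp := Real.rpow_le_rpow hW0 hWM hp0
    rw [Real.mul_rpow hM0 hX0.le] at hVp hWp
    calc |V ^ S.p - W ^ S.p| ≤ M ^ S.p * X ^ S.p := by
          have := Real.rpow_nonneg hV0 S.p
          have := Real.rpow_nonneg hW0 S.p
          rw [abs_le]; constructor <;> linarith
      _ ≤ (M ^ S.p + S.p * M ^ (S.p - 1) * C₀) * (1 * X ^ S.p) := by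
          rw [one_mul]; gcongr; linarith
      _ ≤ _ := by
          gcongr
          have : 0 ≤ S.N k ^ (-δ) := by positivity
          linarith
  · rw [Set.indicator_of_notMem hin, add_zero]
    rw [mem_ball_iff_norm, not_lt] at hin
    have hXX : X ^ (S.p - 1) * X = X ^ S.p := by
      rw [← Real.rpow_add_one hX0.ne', sub_add_cancel]
    calc |V ^ S.p - W ^ S.p| ≤ S.p * (M * X) ^ (S.p - 1) * |V - W| :=
          abs_rpow_sub_rpow_le hp hV0 hVM hW0 hWM
      _ ≤ S.p * (M * X) ^ (S.p - 1) * (C₀ * S.N k ^ (-δ) * X) := by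
          gcongr
          exact hvest k y hy hin
      _ = S.p * M ^ (S.p - 1) * C₀ * (S.N k ^ (-δ) * (X ^ (S.p - 1) * X)) := by
          rw [Real.mul_rpow hM0 hX0.le]; ring
      _ ≤ _ := by
          rw [hXX]
          gcongr
          have : 0 ≤ M ^ S.p := by positivity
          linarith

end BlowupSetup

/-- Sharp estimate of `u_k` and its gradient on the annulus `|x - x_k| = 2 d_k` in terms of
the iterated kernel `G̃(x,y) = ∫_Ω G(x,z) G(z,y)^p dz`, in the regime `1 ≤ p < n/(n-2)`. -/
theorem u_estimate_on_annulus_subrange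
    (n : ℕ) (hn : 5 ≤ n) (S : BlowupSetup n)
    (hp2 : S.p < (n : ℝ) / ((n : ℝ) - 2))
    (hd0 : Filter.Tendsto S.d Filter.atTop (nhds 0))
    (C₀ : ℝ) (hC₀ : 0 < C₀)
    (hvbd : ∀ k, ∀ y ∈ S.Ω,
      S.v k y ≤ C₀ * S.lam k ^ ((n : ℝ) / (S.p + 1))
        * (1 + S.lam k * ‖y - S.xk k‖) ^ ((2 : ℝ) - n))
    (δ A : ℝ) (hδ : 0 < δ) (hA : 0 < A)
    (Ak : ℕ → ℝ) (hAk_pos : ∀ k, 0 < Ak k)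
    (hAk : Filter.Tendsto Ak Filter.atTop (nhds A))
    (hvest : ∀ k, ∀ y ∈ S.Ω, 2 * S.d k / Real.sqrt (S.N k) ≤ ‖y - S.xk k‖ →
      |S.lam k ^ ((n : ℝ) / (S.qk k + 1)) * S.v k y - Ak k * S.G y (S.xk k)|
        ≤ C₀ * S.N k ^ (-δ) * ‖y - S.xk k‖ ^ (-((n : ℝ) - 2)))
    (Gt : Euc n → Euc n → ℝ)
    (hGt : ∀ x y, Gt x y = ∫ z in S.Ω, S.G x z * (S.G z y) ^ S.p) :
    (∀ k, DifferentiableOn ℝ (S.u k) S.Ω) ∧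
    ∃ η : ℕ → ℝ, (∀ k, 0 ≤ η k) ∧ Filter.Tendsto η Filter.atTop (nhds 0) ∧
      ∀ k, ∀ x : Euc n, ‖x - S.xk k‖ = 2 * S.d k →
        |S.u k x - Ak k ^ S.p * S.lam k ^ (-((n : ℝ) * S.p / (S.qk k + 1))) * Gt x (S.xk k)|
            ≤ η k * S.lam k ^ (-((n : ℝ) * S.p / (S.qk k + 1)))
                * S.d k ^ (-(((n : ℝ) - 2) * S.p - 2)) ∧
        ‖gradient (S.u k) x
            - (Ak k ^ S.p * S.lam k ^ (-((n : ℝ) * S.p / (S.qk k + 1)))) •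
                gradient (fun z => Gt z (S.xk k)) x‖
            ≤ η k * S.lam k ^ (-((n : ℝ) * S.p / (S.qk k + 1)))
                * S.d k ^ (-(((n : ℝ) - 2) * S.p - 1)) := by
  have hn5 : (5 : ℝ) ≤ n := by exact_mod_cast hn
  have hp := S.hp
  have hp0 : 0 ≤ S.p := by linarith
  set β : ℝ := ((n : ℝ) - 2) * S.p with hβ
  have hβn : β < n := by
    rw [lt_div_iff₀ (by linarith)] at hp2
    linarith
  have hβ2 : 2 < β := by nlinarith
  have hbound : ∀ k, ∀ y ∈ S.Ω, S.v k y ≤ C₀ * S.lam k ^ ((n : ℝ) / (S.p + 1)) := fun k y hy => by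
    have hl := S.lam_pos k
    refine (hvbd k y hy).trans (mul_le_of_le_one_right (by positivity) ?_)
    refine Real.rpow_le_one_of_one_le_of_nonpos ?_ (by linarith)
    have : 0 ≤ S.lam k * ‖y - S.xk k‖ := by positivity
    linarith
  have hu : ∀ k, ∀ x ∈ S.Ω, IntegrableOn (fun y => S.G x y * S.v k y ^ S.p) S.Ω ∧
      IntegrableOn (fun y => S.v k y ^ S.p • fderiv ℝ (fun z => S.G z y) x) S.Ω ∧
      HasFDerivAt (S.u k) (∫ y in S.Ω, S.v k y ^ S.p • fderiv ℝ (fun z => S.G z y) x) x := by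
    intro k x hx
    obtain ⟨i, b⟩ := S.integrableOn_v_rpow k (hbound k)
    obtain ⟨h1, h2, h3⟩ := S.hasFDerivAt_potential (by omega) hx i one_pos fun y _ hy => b y hy
    refine ⟨h1, h2, h3.congr_of_eventuallyEq ?_⟩
    filter_upwards [S.hΩo.mem_nhds hx] with z hz using S.hu_eq k z hz
  have hgt : ∀ k, ∀ x ∈ S.Ω, x ≠ S.xk k →
      IntegrableOn (fun y => S.G x y * S.G y (S.xk k) ^ S.p) S.Ω ∧
      IntegrableOn (fun y => S.G y (S.xk k) ^ S.p • fderiv ℝ (fun z => S.G z y) x) S.Ω ∧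
      HasFDerivAt (fun z => Gt z (S.xk k))
        (∫ y in S.Ω, S.G y (S.xk k) ^ S.p • fderiv ℝ (fun z => S.G z y) x) x := by
    intro k x hx hne
    have ht : 0 < ‖x - S.xk k‖ := norm_pos_iff.2 (sub_ne_zero.2 hne)
    have hc := cGreen_nonneg (n := n) (by omega)
    simp_rw [hGt]
    refine S.hasFDerivAt_potential (by omega) hx
      (S.integrableOn_G_rpow (by omega) hβn (S.hxk k)) (half_pos ht)
      (B := cGreen n ^ S.p * (‖x - S.xk k‖ / 2) ^ (-β)) fun y hy hyΩ => ?_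
    have h1 : ‖x - S.xk k‖ / 2 ≤ ‖S.xk k - y‖ := by
      rw [mem_ball_iff_norm] at hy
      have := norm_sub_le_norm_sub_add_norm_sub x y (S.xk k)
      rw [norm_sub_rev x y, norm_sub_rev y (S.xk k)] at this
      linarith
    have hyx : y ≠ S.xk k := by
      rintro rfl; simp only [sub_self, norm_zero] at h1; linarith
    refine (S.abs_G_rpow_le (by omega) (S.hxk k) hyΩ hyx).trans ?_
    exact mul_le_mul_of_nonneg_left
      (Real.rpow_le_rpow_of_nonpos (by positivity) h1 (by linarith)) (by positivity)
  refine ⟨fun k x hx => (hu k x hx).2.2.differentiableAt.differentiableWithinAt, ?_⟩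
  obtain ⟨C₁, hC₁, hpot⟩ := S.exists_norm_potential_le (by omega) hβn hβ2
  obtain ⟨C₂, hC₂, hden⟩ := S.exists_density_sub_le (by omega) hC₀ hvbd hAk_pos hAk hvest
  have hN : ∀ k, 0 < S.N k := S.N_pos (by omega)
  refine ⟨fun k => C₁ * (C₂ * (S.N k ^ (-δ) + (2 / Real.sqrt (S.N k)) ^ ((n : ℝ) - β))),
    fun k => by have := hN k; positivity, ?_, fun k x hx => ?_⟩
  · have hNt : Tendsto S.N atTop atTop := S.hN_top
    have t1 : Tendsto (fun k => S.N k ^ (-δ)) atTop (𝓝 0) :=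
      (tendsto_rpow_neg_atTop hδ).comp hNt
    have t2 : Tendsto (fun k => (2 / Real.sqrt (S.N k)) ^ ((n : ℝ) - β)) atTop (𝓝 0) := by
      have := ((Real.tendsto_sqrt_atTop.comp hNt).const_div_atTop 2).rpow_const
        (p := (n : ℝ) - β) (Or.inr (by linarith))
      rwa [Real.zero_rpow (by linarith)] at this
    simpa using ((t1.add t2).const_mul C₂).const_mul C₁
  · have hd := S.d_pos (by omega) k
    have hl := S.lam_pos k
    have hNk := hN k
    have hball : ball x (2 * S.d k) ⊆ S.Ω := by
      refine fun z hz => S.ball_xk_subset (by omega) k ?_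
      rw [mem_ball_iff_norm] at hz ⊢
      linarith [norm_sub_le_norm_sub_add_norm_sub z x (S.xk k)]
    have hxΩ : x ∈ S.Ω := hball (mem_ball_self (by positivity))
    have hne : x ≠ S.xk k := by
      rintro rfl; simp at hx; linarith
    obtain ⟨i₁, j₁, D₁⟩ := hu k x hxΩ
    obtain ⟨i₂, j₂, D₂⟩ := hgt k x hxΩ hne
    set Λ := S.lam k ^ ((n : ℝ) * S.p / (S.qk k + 1)) with hΛ
    have hΛ0 : 0 < Λ := by positivity
    rw [Real.rpow_neg hl.le, ← hΛ]
    set a := Ak k ^ S.p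
    have hρ : 2 * S.d k / Real.sqrt (S.N k) / S.d k = 2 / Real.sqrt (S.N k) := by field_simp
    obtain ⟨b₁, b₂⟩ := hpot (S.d k) hd x (S.xk k) hx hball C₂ (S.N k ^ (-δ))
      (2 * S.d k / Real.sqrt (S.N k)) hC₂ (by positivity) (by positivity) _ (hden k)
    rw [hρ] at b₁ b₂
    have s₁ : ∫ y in S.Ω, S.G x y * (Λ * S.v k y ^ S.p - a * S.G y (S.xk k) ^ S.p) =
        Λ * S.u k x - a * Gt x (S.xk k) := by
      rw [S.hu_eq k x hxΩ, hGt, ← integral_const_mul, ← integral_const_mul,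
        ← integral_sub (i₁.const_mul Λ) (i₂.const_mul a)]
      congr 1; funext y; ring
    have s₂ : ∫ y in S.Ω, (Λ * S.v k y ^ S.p - a * S.G y (S.xk k) ^ S.p) •
        fderiv ℝ (fun z => S.G z y) x =
        Λ • fderiv ℝ (S.u k) x - a • fderiv ℝ (fun z => Gt z (S.xk k)) x := by
      have j₁' : IntegrableOn (fun y => Λ • S.v k y ^ S.p • fderiv ℝ (fun z => S.G z y) x) S.Ω :=
        j₁.smul Λ
      have j₂' : IntegrableOn
          (fun y => a • S.G y (S.xk k) ^ S.p • fderiv ℝ (fun z => S.G z y) x) S.Ω := j₂.smul a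
      rw [D₁.fderiv, D₂.fderiv, ← integral_smul, ← integral_smul, ← integral_sub j₁' j₂']
      congr 1; funext y; rw [sub_smul, mul_smul, mul_smul]
    rw [s₁] at b₁
    rw [s₂] at b₂
    constructor
    · have : S.u k x - a * Λ⁻¹ * Gt x (S.xk k) = Λ⁻¹ * (Λ * S.u k x - a * Gt x (S.xk k)) := by
        field_simp
      rw [this, abs_mul, abs_of_pos (inv_pos.2 hΛ0), neg_sub]
      calc _ ≤ _ := mul_le_mul_of_nonneg_left b₁ (inv_pos.2 hΛ0).le
        _ = _ := by ring
    · have : gradient (S.u k) x - (a * Λ⁻¹) • gradient (fun z => Gt z (S.xk k)) x =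
          (InnerProductSpace.toDual ℝ (Euc n)).symm
            (Λ⁻¹ • (Λ • fderiv ℝ (S.u k) x - a • fderiv ℝ (fun z => Gt z (S.xk k)) x)) := by
        rw [smul_sub, inv_smul_smul₀ hΛ0.ne', smul_smul, mul_comm Λ⁻¹, map_sub, map_smulₛₗ]
        rfl
      rw [this, LinearIsometryEquiv.norm_map, norm_smul, Real.norm_of_nonneg (inv_pos.2 hΛ0).le,
        neg_sub]
      calc _ ≤ _ := mul_le_mul_of_nonneg_left b₂ (inv_pos.2 hΛ0).le
        _ = _ := by ring
end
end

section
/- Let n ≥ 5 and 1 ≤ p < (n−1)/(n−2), and set α₁ := c_nᵖ/(((n−2)p−2)(n−(n−2)p)). Define g : ℝⁿ₊∖{e_n} → ℝ by g(z) := c_nᵖ|z−e_n|^{−(n−2)p} − (c_n|z−e_n|^{2−n} − c_n|z+e_n|^{2−n})ᵖ, and for x ∈ ℝⁿ₊ define W₀(x) := ∫_{ℝⁿ₊} (c_n|z−x|^{2−n} − c_n|z−x*|^{2−n}) g(z) dz + 2(n−2) c_n α₁ ∫_{ℝ^{n−1}} (x_n/|x−(y,0)|ⁿ) |(y,0)−e_n|^{−((n−2)p−2)}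 dy. Then all these integrals converge absolutely, the function t ↦ W₀(e_n + (t−1)e_n) is differentiable at t = 1 (i.e. W₀ has a partial derivative in the x_n-direction at e_n), and ∂W₀/∂x_n(e_n) = 2(n−2) c_n α₁ ∫_{ℝ^{n−1}} ( |(y,0)−e_n|^{−(n−2)(p+1)} − n|(y,0)−e_n|^{−((n−2)p+n)} ) dy − (n−2) c_n ∫_{ℝⁿ₊} ( (1−z_n)|z−e_n|^{−n} − (1+z_n)|z+e_n|^{−n} ) g(z) dz. -/
open MeasureTheory Metric Filter Topology RealInnerProductSpace

noncomputable section

/-- Reflection `x ↦ x*` across the hyperplane `{x_i = 0}`. -/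
noncomputable def reflct {n : ℕ} (i : Fin n) (x : Euc n) : Euc n :=
  x - (2 * x i) • EuclideanSpace.single i 1

/-- Green function of `-Δ` on the half-space `{x_i > 0}`. -/
noncomputable def G0 (n : ℕ) (i : Fin n) (x y : Euc n) : ℝ :=
  cGreen n * (‖x - y‖ ^ ((2 : ℝ) - n) - ‖x - reflct i y‖ ^ ((2 : ℝ) - n))

/-- `α₁ = c_nᵖ/(((n-2)p-2)(n-(n-2)p))`. -/
noncomputable def alpha1 (n : ℕ) (p : ℝ) : ℝ :=
  cGreen n ^ p / ((((n : ℝ) - 2) * p - 2) * ((n : ℝ) - ((n : ℝ) - 2) * p))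

/-- Dominated convergence with dominating functions that vary along the filter. -/
theorem tendsto_integral_of_tendsto_dominating {α ι : Type*} [MeasurableSpace α] {μ : Measure α}
    {l : Filter ι} [l.IsCountablyGenerated] {F H : ι → α → ℝ} {f h : α → ℝ}
    (hF : ∀ᶠ k in l, AEStronglyMeasurable (F k) μ) (hH : ∀ᶠ k in l, Integrable (H k) μ)
    (hh : Integrable h μ) (hbound : ∀ᶠ k in l, ∀ᵐ x ∂μ, |F k x| ≤ H k x)
    (hH0 : ∀ᶠ k in l, ∀ᵐ x ∂μ, 0 ≤ H k x)
    (hfh : ∀ᵐ x ∂μ, |f x| ≤ h x) (hlim : ∀ᵐ x ∂μ, Tendsto (fun k => F k x) l (𝓝 (f x)))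
    (hHlim : ∀ᵐ x ∂μ, Tendsto (fun k => H k x) l (𝓝 (h x)))
    (hint : Tendsto (fun k => ∫ x, H k x ∂μ) l (𝓝 (∫ x, h x ∂μ))) :
    Tendsto (fun k => ∫ x, F k x ∂μ) l (𝓝 (∫ x, f x ∂μ)) := by
  set P : ι → α → ℝ := fun k x => max (-h x) (min (h x) (F k x)) with hP
  have hclip : Tendsto (fun k => ∫ x, P k x ∂μ) l (𝓝 (∫ x, f x ∂μ)) := by
    refine tendsto_integral_filter_of_dominated_convergence h ?_ ?_ hh ?_
    · filter_upwards [hF] with k hk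
      exact hh.aestronglyMeasurable.neg.sup (hh.aestronglyMeasurable.inf hk)
    · refine Eventually.of_forall fun k => ?_
      filter_upwards [hfh] with x hx
      have h0 : 0 ≤ h x := (abs_nonneg _).trans hx
      rw [Real.norm_eq_abs, abs_le]
      exact ⟨le_max_left _ _, max_le (by linarith) (min_le_left _ _)⟩
    · filter_upwards [hfh, hlim] with x hx hx'
      have hfx : max (-h x) (min (h x) (f x)) = f x := by
        rw [min_eq_right (abs_le.1 hx).2, max_eq_right (abs_le.1 hx).1]
      rw [← hfx]
      exact tendsto_const_nhds.max (tendsto_const_nhds.min hx')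
  have hmin : Tendsto (fun k => ∫ x, min (H k x) (h x) ∂μ) l (𝓝 (∫ x, h x ∂μ)) := by
    refine tendsto_integral_filter_of_dominated_convergence h ?_ ?_ hh ?_
    · filter_upwards [hH] with k hk
      exact hk.aestronglyMeasurable.inf hh.aestronglyMeasurable
    · filter_upwards [hH0] with k hk
      filter_upwards [hfh, hk] with x hx hkx
      have h0 : 0 ≤ h x := (abs_nonneg _).trans hx
      rw [Real.norm_of_nonneg (le_min hkx h0)]
      exact min_le_right _ _
    · filter_upwards [hHlim] with x hx
      simpa using hx.min (tendsto_const_nhds (x := h x))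
  have hgap : Tendsto (fun k => (∫ x, H k x ∂μ) - ∫ x, min (H k x) (h x) ∂μ) l (𝓝 0) := by
    simpa using hint.sub hmin
  have hrem : Tendsto (fun k => (∫ x, F k x ∂μ) - ∫ x, P k x ∂μ) l (𝓝 0) := by
    refine squeeze_zero_norm' ?_ hgap
    filter_upwards [hF, hH, hbound, hH0] with k hFk hHk hb h0
    have hFi : Integrable (F k) μ := hHk.mono' hFk hb
    have hPi : Integrable (P k) μ := hh.neg.sup (hh.inf hFi)
    have hmi : Integrable (fun x => min (H k x) (h x)) μ := hHk.inf hh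
    rw [← integral_sub hFi hPi, ← integral_sub hHk hmi]
    refine norm_integral_le_of_norm_le (hHk.sub hmi) ?_
    filter_upwards [hb, hfh] with x hx hx'
    have hx0 : 0 ≤ h x := (abs_nonneg _).trans hx'
    rw [Real.norm_eq_abs]
    simp only [hP]
    rcases abs_le.1 hx with ⟨h1, h2⟩
    rcases le_total (H k x) (h x) with h3 | h3
    · rw [min_eq_left h3, min_eq_right (h2.trans h3), max_eq_right (by linarith)]
      simp
    · rw [min_eq_right h3, abs_le]
      rcases le_total (h x) (F k x) with h4 | h4
      · rw [min_eq_left h4, max_eq_right (by linarith)]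
        constructor <;> linarith
      · rw [min_eq_right h4]
        rcases le_total (-h x) (F k x) with h5 | h5
        · rw [max_eq_right h5]; constructor <;> linarith
        · rw [max_eq_left h5]; constructor <;> linarith
  simpa using hrem.add hclip

/-- The profile `r⁻ˢ min(1, r⁻ᵐ)`. -/
def cutProfile (m s r : ℝ) : ℝ := r ^ (-s) * min 1 (r ^ (-m))

theorem cutProfile_nonneg {m s r : ℝ} (hr : 0 ≤ r) : 0 ≤ cutProfile m s r :=
  mul_nonneg (Real.rpow_nonneg hr _) (le_min zero_le_one (Real.rpow_nonneg hr _))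

theorem measurable_cutProfile (m s : ℝ) : Measurable (cutProfile m s) := by
  unfold cutProfile
  fun_prop

theorem continuousAt_cutProfile {m s r : ℝ} (hr : 0 < r) : ContinuousAt (cutProfile m s) r :=
  (Real.continuousAt_rpow_const _ _ (.inl hr.ne')).mul
    (continuousAt_const.min (Real.continuousAt_rpow_const _ _ (.inl hr.ne')))

theorem cutProfile_le_cutProfile {m s a b : ℝ} (hm : 0 ≤ m) (hs : 0 ≤ s) (ha : 0 < a)
    (hab : a ≤ b) : cutProfile m s b ≤ cutProfile m s a :=
  mul_le_mul (Real.rpow_le_rpow_of_nonpos ha hab (by linarith))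
    (min_le_min_left _ (Real.rpow_le_rpow_of_nonpos ha hab (by linarith)))
    (le_min zero_le_one (Real.rpow_nonneg (ha.le.trans hab) _)) (Real.rpow_nonneg ha.le _)

theorem rpow_neg_mul_cutProfile {m s β r : ℝ} (hr : 0 < r) :
    r ^ (-β) * cutProfile m s r = cutProfile m (β + s) r := by
  rw [cutProfile, cutProfile, ← mul_assoc, ← Real.rpow_add hr, neg_add]

theorem rpow_neg_mul_cutProfile_le {m s β a b : ℝ} (hm : 0 ≤ m) (hs : 0 ≤ s) (hβ : 0 ≤ β)
    (ha : 0 < a) (hb : 0 < b) :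
    a ^ (-β) * cutProfile m s b ≤ cutProfile m (β + s) a + cutProfile m (β + s) b := by
  rcases le_total a b with h | h
  · have := mul_le_mul_of_nonneg_left (cutProfile_le_cutProfile hm hs ha h)
      (Real.rpow_nonneg ha.le (-β))
    rw [rpow_neg_mul_cutProfile ha] at this
    linarith [cutProfile_nonneg (m := m) (s := β + s) hb.le]
  · have := mul_le_mul_of_nonneg_right
      (Real.rpow_le_rpow_of_nonpos hb h (by linarith : -β ≤ 0)) (cutProfile_nonneg (m := m) (s := s) hb.le)
    rw [rpow_neg_mul_cutProfile hb] at this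
    linarith [cutProfile_nonneg (m := m) (s := β + s) ha.le]

theorem integrable_cutProfile_norm {n : ℕ} (hn : 1 ≤ n) {m s : ℝ} (hs : s < n)
    (hms : (n : ℝ) < m + s) : Integrable (fun z : Euc n => cutProfile m s ‖z‖) := by
  have hfin : Module.finrank ℝ (Euc n) = n := by simp
  have : Nontrivial (Euc n) := Module.nontrivial_of_finrank_pos (R := ℝ) (by omega)
  rw [integrable_fun_norm_addHaar volume (f := cutProfile m s), hfin,
    ← Set.Ioo_union_Ici_eq_Ioi zero_lt_one]
  have hmeas : Measurable fun y : ℝ => y ^ (n - 1) • cutProfile m s y :=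
    (measurable_id.pow_const _).smul (measurable_cutProfile m s)
  have hpow : ∀ y : ℝ, 0 < y → ∀ b : ℝ, y ^ (n - 1) * y ^ (-b) = y ^ ((n : ℝ) - 1 - b) := by
    intro y hy b
    rw [← Real.rpow_natCast, ← Real.rpow_add hy, Nat.cast_sub hn, Nat.cast_one, ← sub_eq_add_neg]
  refine IntegrableOn.union ?_ ?_
  · refine Integrable.mono' ((intervalIntegral.integrableOn_Ioo_rpow_iff zero_lt_one).2
      (by linarith : -1 < (n : ℝ) - 1 - s)) hmeas.aestronglyMeasurable ?_
    refine (ae_restrict_iff' measurableSet_Ioo).2 (Eventually.of_forall fun y hy => ?_)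
    have h0 : (0 : ℝ) < y := hy.1
    rw [smul_eq_mul, Real.norm_of_nonneg (mul_nonneg (by positivity) (cutProfile_nonneg h0.le)),
      ← hpow y h0]
    refine mul_le_mul_of_nonneg_left ?_ (by positivity)
    exact mul_le_of_le_one_right (Real.rpow_nonneg h0.le _) (min_le_left _ _)
  · refine Integrable.mono' ((integrableOn_Ici_iff_integrableOn_Ioi (by simp)).2 (integrableOn_Ioi_rpow_of_lt
      (by linarith : (n : ℝ) - 1 - (s + m) < -1) zero_lt_one)) hmeas.aestronglyMeasurable ?_
    refine (ae_restrict_iff' measurableSet_Ici).2 (Eventually.of_forall fun y hy => ?_)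
    have h0 : (0 : ℝ) < y := zero_lt_one.trans_le hy
    rw [smul_eq_mul, Real.norm_of_nonneg (mul_nonneg (by positivity) (cutProfile_nonneg h0.le)),
      ← hpow y h0, neg_add, Real.rpow_add h0]
    refine mul_le_mul_of_nonneg_left ?_ (by positivity)
    exact mul_le_mul_of_nonneg_left (min_le_right _ _) (Real.rpow_nonneg h0.le _)

theorem integrable_cutProfile_norm_sub {n : ℕ} (hn : 1 ≤ n) {m s : ℝ} (hs : s < n)
    (hms : (n : ℝ) < m + s) (x : Euc n) :
    Integrable (fun z : Euc n => cutProfile m s ‖z - x‖) :=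
  (integrable_cutProfile_norm hn hs hms).comp_sub_right x

theorem norm_sub_smul_single_sq {n : ℕ} (i : Fin n) (z : Euc n) (t : ℝ) :
    ‖z - t • EuclideanSpace.single i 1‖ ^ 2 = ‖z‖ ^ 2 - 2 * t * z i + t ^ 2 := by
  rw [norm_sub_sq_real, real_inner_smul_right, EuclideanSpace.inner_single_right, norm_smul,
    PiLp.norm_single, mul_pow]
  simp
  ring

theorem hasDerivAt_norm_sub_smul_single_rpow {n : ℕ} (i : Fin n) (z : Euc n) {t : ℝ}
    (h : z ≠ t • EuclideanSpace.single i 1) (a : ℝ) :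
    HasDerivAt (fun u : ℝ => ‖z - u • EuclideanSpace.single i 1‖ ^ a)
      (a * ‖z - t • EuclideanSpace.single i 1‖ ^ (a - 2) * (t - z i)) t := by
  have hpos : 0 < ‖z - t • EuclideanSpace.single i 1‖ := norm_pos_iff.2 (sub_ne_zero.2 h)
  have hsq : ∀ u b : ℝ, ‖z - u • EuclideanSpace.single i 1‖ ^ b =
      (‖z‖ ^ 2 - 2 * u * z i + u ^ 2) ^ (b / 2) := by
    intro u b
    rw [← norm_sub_smul_single_sq, ← Real.rpow_natCast, ← Real.rpow_mul (norm_nonneg _)]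
    congr 1
    push_cast
    ring
  have hq : HasDerivAt (fun u : ℝ => ‖z‖ ^ 2 - 2 * u * z i + u ^ 2) (2 * (t - z i)) t := by
    have := ((((hasDerivAt_id t).const_mul 2).mul_const (z i)).const_sub (‖z‖ ^ 2)).add
      ((hasDerivAt_id t).pow 2)
    refine this.congr_deriv ?_
    simp
    ring
  have hne : ‖z‖ ^ 2 - 2 * t * z i + t ^ 2 ≠ 0 := by
    rw [← norm_sub_smul_single_sq]
    positivity
  have := hq.rpow_const (p := a / 2) (.inl hne)
  simp only [hsq]
  refine this.congr_deriv ?_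
  rw [show (a - 2) / 2 = a / 2 - 1 by ring]
  ring

theorem abs_rpow_neg_sub_rpow_neg_le {m a b : ℝ} (hm : 0 ≤ m) (ha : 0 < a) (hb : 0 < b) :
    |a ^ (-m) - b ^ (-m)| ≤ m * (a ^ (-(m + 1)) + b ^ (-(m + 1))) * |a - b| := by
  have key : ∀ a b : ℝ, 0 < a → a ≤ b →
      |a ^ (-m) - b ^ (-m)| ≤ m * (a ^ (-(m + 1)) + b ^ (-(m + 1))) * |a - b| := by
    intro a b ha hab
    have := (convex_Icc a b).norm_image_sub_le_of_norm_hasDerivWithin_le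
      (f := fun r : ℝ => r ^ (-m)) (f' := fun r => -m * r ^ (-m - 1)) (C := m * a ^ (-(m + 1)))
      (fun r hr => (Real.hasDerivAt_rpow_const
        (.inl (ha.trans_le hr.1).ne')).hasDerivWithinAt) (fun r hr => ?_)
      (Set.right_mem_Icc.2 hab) (Set.left_mem_Icc.2 hab)
    · refine this.trans (mul_le_mul_of_nonneg_right (mul_le_mul_of_nonneg_left ?_ hm)
        (norm_nonneg _))
      linarith [Real.rpow_nonneg (ha.le.trans hab) (-(m + 1))]
    · rw [norm_mul, norm_neg, Real.norm_of_nonneg hm,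
        Real.norm_of_nonneg (Real.rpow_nonneg (ha.le.trans hr.1) _),
        show -m - 1 = -(m + 1) by ring]
      exact mul_le_mul_of_nonneg_left
        (Real.rpow_le_rpow_of_nonpos ha hr.1 (by linarith)) hm
  rcases le_total a b with h | h
  · exact key a b ha h
  · rw [abs_sub_comm, abs_sub_comm a b, add_comm (a ^ (-(m + 1)))]
    exact key b a hb h

theorem rpow_sub_rpow_sub_le {a b p : ℝ} (ha : 0 < a) (hba : b ≤ a) (hp : 1 ≤ p) :
    a ^ p - (a - b) ^ p ≤ p * a ^ (p - 1) * b := by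
  have hr : b / a ≤ 1 := (div_le_one ha).2 hba
  have h := one_add_mul_self_le_rpow_one_add (s := -(b / a)) (by linarith) hp
  have h2 : (a - b) ^ p = a ^ p * (1 + -(b / a)) ^ p := by
    rw [← Real.mul_rpow ha.le (by linarith)]
    congr 1
    field_simp
    ring
  have h3 : a ^ p = a ^ (p - 1) * a := by
    rw [← Real.rpow_add_one ha.ne', sub_add_cancel]
  have h4 : a ^ p * (1 + p * -(b / a)) ≤ (a - b) ^ p := by
    rw [h2]
    exact mul_le_mul_of_nonneg_left h (Real.rpow_nonneg ha.le _)
  have h5 : a ^ p * (b / a) = a ^ (p - 1) * b := by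
    rw [h3]
    field_simp
  nlinarith [h4, h5]

theorem norm_sub_le_norm_sub_reflct {n : ℕ} {i : Fin n} {z x : Euc n} (hz : 0 ≤ z i)
    (hx : 0 ≤ x i) : ‖z - x‖ ≤ ‖z - reflct i x‖ := by
  have h := norm_sub_smul_single_sq i (z - x) (-(2 * x i))
  have h1 : z - x - (-(2 * x i)) • EuclideanSpace.single i 1 = z - reflct i x := by
    rw [reflct]
    module
  rw [h1] at h
  refine le_of_sq_le_sq ?_ (norm_nonneg _)
  rw [h]
  simp only [PiLp.sub_apply]
  nlinarith [mul_nonneg hz hx]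

theorem reflct_smul_single {n : ℕ} (i : Fin n) (t : ℝ) :
    reflct i (t • EuclideanSpace.single i 1 : Euc n) = -(t • EuclideanSpace.single i 1) := by
  rw [reflct]
  simp only [PiLp.smul_apply, PiLp.single_apply, if_true, smul_eq_mul, mul_one]
  module

theorem integrableOn_hyperplane_one_add_norm {n : ℕ} (i : Fin n) {r : ℝ} (hr : (n : ℝ) - 1 < r) :
    IntegrableOn (fun y : Euc n => (1 + ‖y‖) ^ (-r)) {z : Euc n | z i = 0} (surf n) := by
  let f : Module.Dual ℝ (Euc n) := (EuclideanSpace.proj i : Euc n →L[ℝ] ℝ).toLinearMap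
  have hf : f ≠ 0 := by
    intro h
    have := LinearMap.congr_fun h (EuclideanSpace.single i 1)
    simp [f] at this
  have hfin : (Module.finrank ℝ (LinearMap.ker f) : ℝ) = (n : ℝ) - 1 := by
    have := Module.Dual.finrank_ker_add_one_of_ne_zero hf
    rw [finrank_euclideanSpace_fin] at this
    have h' : (Module.finrank ℝ (LinearMap.ker f) : ℝ) + 1 = n := by exact_mod_cast this
    linarith
  have hset : {z : Euc n | z i = 0} = Set.range (Subtype.val : LinearMap.ker f → Euc n) := by
    ext z
    simp [f]
  have hn : (0 : ℝ) ≤ (n : ℝ) - 1 := hfin ▸ Nat.cast_nonneg _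
  have hmap := (LinearMap.ker f).subtypeₗᵢ.isometry.map_hausdorffMeasure (d := (n : ℝ) - 1) (.inl hn)
  rw [Submodule.coe_subtypeₗᵢ, Submodule.coe_subtype] at hmap
  rw [IntegrableOn, surf, hset, ← hmap]
  have hemb : MeasurableEmbedding (Subtype.val : LinearMap.ker f → Euc n) :=
    MeasurableEmbedding.subtype_coe (LinearMap.ker f).closed_of_finiteDimensional.measurableSet
  refine hemb.integrable_map_iff.2 ?_
  rw [← hfin]
  exact integrable_one_add_norm (E := LinearMap.ker f) (hfin ▸ hr)

theorem measurableSet_coord_pos {n : ℕ} (i : Fin n) : MeasurableSet {z : Euc n | 0 < z i} :=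
  measurableSet_lt measurable_const (by fun_prop)

theorem measurableSet_coord_eq_zero {n : ℕ} (i : Fin n) : MeasurableSet {z : Euc n | z i = 0} :=
  measurableSet_eq_fun (by fun_prop) measurable_const

theorem abs_coord_le_norm {n : ℕ} (z : Euc n) (i : Fin n) : |z i| ≤ ‖z‖ := by
  simpa using PiLp.norm_apply_le z i

theorem norm_sub_smul_single_le_norm_add {n : ℕ} {i : Fin n} {z : Euc n} {t : ℝ} (hz : 0 ≤ z i)
    (ht : 0 ≤ t) : ‖z - t • EuclideanSpace.single i 1‖ ≤ ‖z + t • EuclideanSpace.single i 1‖ := by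
  have := norm_sub_le_norm_sub_reflct (x := t • EuclideanSpace.single i 1) hz (by simpa using ht)
  rwa [reflct_smul_single, sub_neg_eq_add] at this

theorem norm_sub_single_le_norm_add {n : ℕ} {i : Fin n} {z : Euc n} (hz : 0 ≤ z i) :
    ‖z - EuclideanSpace.single i 1‖ ≤ ‖z + EuclideanSpace.single i 1‖ := by
  simpa using norm_sub_smul_single_le_norm_add hz zero_le_one

/-- The difference between the `p`-th powers of the free and the half-space Green functions
is controlled by a radial profile with an integrable singularity at the pole. -/
theorem abs_green_power_defect_le {n : ℕ} (hn : 2 ≤ (n : ℝ)) {i : Fin n} {c p : ℝ} (hc : 0 ≤ c)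
    (hp : 1 ≤ p) {z : Euc n} (hz : 0 < z i) (hze : z ≠ EuclideanSpace.single i 1) :
    |c ^ p * ‖z - EuclideanSpace.single i 1‖ ^ (-(((n : ℝ) - 2) * p))
        - (c * ‖z - EuclideanSpace.single i 1‖ ^ ((2 : ℝ) - n)
            - c * ‖z + EuclideanSpace.single i 1‖ ^ ((2 : ℝ) - n)) ^ p|
      ≤ c ^ p * p * cutProfile (n - 2) ((n - 2) * (p - 1)) ‖z - EuclideanSpace.single i 1‖ := by
  have hpos : 0 < ‖z - EuclideanSpace.single i 1‖ := norm_pos_iff.2 (sub_ne_zero.2 hze)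
  have hle := norm_sub_single_le_norm_add hz.le
  have hone : 1 ≤ ‖z + EuclideanSpace.single i 1‖ := by
    have := (le_abs_self _).trans (abs_coord_le_norm (z + EuclideanSpace.single i 1) i)
    simp only [PiLp.add_apply, PiLp.single_apply, if_true] at this
    linarith
  set r := ‖z - EuclideanSpace.single i 1‖
  set R := ‖z + EuclideanSpace.single i 1‖
  have hRpos : 0 < R := hpos.trans_le hle
  rw [show (2 : ℝ) - n = -(n - 2) by ring]
  set a := r ^ (-((n : ℝ) - 2)) with ha
  set b := R ^ (-((n : ℝ) - 2))
  have hapos : 0 < a := Real.rpow_pos_of_pos hpos _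
  have hbpos : 0 < b := Real.rpow_pos_of_pos hRpos _
  have hba : b ≤ a := Real.rpow_le_rpow_of_nonpos hpos hle (by linarith)
  have hb1 : b ≤ 1 := Real.rpow_le_one_of_one_le_of_nonpos hone (by linarith)
  have hap : r ^ (-(((n : ℝ) - 2) * p)) = a ^ p := by
    rw [ha, ← Real.rpow_mul hpos.le, neg_mul]
  have hap1 : r ^ (-(((n : ℝ) - 2) * (p - 1))) = a ^ (p - 1) := by
    rw [ha, ← Real.rpow_mul hpos.le, neg_mul]
  have hcp : 0 ≤ c ^ p := Real.rpow_nonneg hc p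
  rw [hap, ← mul_sub, Real.mul_rpow hc (sub_nonneg.2 hba), ← mul_sub, abs_mul, abs_of_nonneg hcp,
    mul_assoc, cutProfile, hap1]
  refine mul_le_mul_of_nonneg_left ?_ hcp
  rw [abs_of_nonneg (sub_nonneg.2 (Real.rpow_le_rpow (sub_nonneg.2 hba) (by linarith)
    (by linarith)))]
  refine (rpow_sub_rpow_sub_le hapos hba hp).trans ?_
  rw [mul_assoc]
  refine mul_le_mul_of_nonneg_left (mul_le_mul_of_nonneg_left (le_min hb1 hba) ?_) (by linarith)
  exact Real.rpow_nonneg hapos.le _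

theorem abs_mul_le_cutProfile {m s β C D K g a b : ℝ} (hm : 0 ≤ m) (hs : 0 ≤ s) (hβ : 0 ≤ β)
    (hC : 0 ≤ C) (ha : 0 < a) (hb : 0 < b) (hK : |K| ≤ D * a ^ (-β))
    (hg : |g| ≤ C * cutProfile m s b) :
    |K * g| ≤ D * C * (cutProfile m (β + s) a + cutProfile m (β + s) b) := by
  have hD : 0 ≤ D := nonneg_of_mul_nonneg_left ((abs_nonneg K).trans hK) (Real.rpow_pos_of_pos ha _)
  rw [abs_mul]
  calc |K| * |g| ≤ (D * a ^ (-β)) * (C * cutProfile m s b) :=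
        mul_le_mul hK hg (abs_nonneg _) ((abs_nonneg K).trans hK)
    _ = D * C * (a ^ (-β) * cutProfile m s b) := by ring
    _ ≤ _ := mul_le_mul_of_nonneg_left (rpow_neg_mul_cutProfile_le hm hs hβ ha hb) (mul_nonneg hD hC)

theorem integrableOn_mul_of_le_cutProfile {n : ℕ} (hn : 1 ≤ n) {S : Set (Euc n)}
    (hS : MeasurableSet S) {m s β C D : ℝ} (hm : 0 ≤ m) (hs : 0 ≤ s) (hβ : 0 ≤ β) (hC : 0 ≤ C)
    (hβs : β + s < n) (hmβs : (n : ℝ) < m + (β + s)) {x e : Euc n} {K g : Euc n → ℝ}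
    (hKm : AEStronglyMeasurable K (volume.restrict S))
    (hgm : AEStronglyMeasurable g (volume.restrict S))
    (hK : ∀ z ∈ S, z ≠ x → |K z| ≤ D * ‖z - x‖ ^ (-β))
    (hg : ∀ z ∈ S, z ≠ e → |g z| ≤ C * cutProfile m s ‖z - e‖) :
    IntegrableOn (fun z => K z * g z) S := by
  have : Nontrivial (Euc n) := Module.nontrivial_of_finrank_pos (R := ℝ) (by simp; omega)
  refine Integrable.mono' ((((integrable_cutProfile_norm_sub hn hβs hmβs x).add
    (integrable_cutProfile_norm_sub hn hβs hmβs e)).const_mul (D * C)).integrableOn)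
    (hKm.mul hgm) ?_
  filter_upwards [ae_restrict_mem hS, ae_restrict_of_ae (Measure.ae_ne volume x),
    ae_restrict_of_ae (Measure.ae_ne volume e)] with z hz hzx hze
  exact abs_mul_le_cutProfile hm hs hβ hC (norm_pos_iff.2 (sub_ne_zero.2 hzx))
    (norm_pos_iff.2 (sub_ne_zero.2 hze)) (hK z hz hzx) (hg z hz hze)

theorem abs_green_kernel_le {n : ℕ} (hn : 2 ≤ (n : ℝ)) {i : Fin n} {c : ℝ} (hc : 0 ≤ c)
    {x z : Euc n} (hx : 0 ≤ x i) (hz : 0 ≤ z i) (hzx : z ≠ x) :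
    |c * ‖z - x‖ ^ ((2 : ℝ) - n) - c * ‖z - reflct i x‖ ^ ((2 : ℝ) - n)|
      ≤ c * ‖z - x‖ ^ (-((n : ℝ) - 2)) := by
  have hpos : 0 < ‖z - x‖ := norm_pos_iff.2 (sub_ne_zero.2 hzx)
  have h := mul_le_mul_of_nonneg_left (Real.rpow_le_rpow_of_nonpos hpos
    (norm_sub_le_norm_sub_reflct hz hx) (by linarith : (2 : ℝ) - n ≤ 0)) hc
  have h0 := mul_nonneg hc (Real.rpow_nonneg (norm_nonneg (z - reflct i x)) ((2 : ℝ) - n))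
  rw [show -((n : ℝ) - 2) = 2 - n by ring, abs_of_nonneg (sub_nonneg.2 h)]
  linarith

theorem abs_green_kernel_deriv_le {n : ℕ} (hn : 1 ≤ (n : ℝ)) {i : Fin n} {z : Euc n}
    (hz : 0 ≤ z i) (hze : z ≠ EuclideanSpace.single i 1) :
    |(1 - z i) * ‖z - EuclideanSpace.single i 1‖ ^ (-(n : ℝ))
        - (1 + z i) * ‖z + EuclideanSpace.single i 1‖ ^ (-(n : ℝ))|
      ≤ 2 * ‖z - EuclideanSpace.single i 1‖ ^ (-((n : ℝ) - 1)) := by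
  have hpos : 0 < ‖z - EuclideanSpace.single i 1‖ := norm_pos_iff.2 (sub_ne_zero.2 hze)
  have hle := norm_sub_single_le_norm_add hz
  have h1 := abs_coord_le_norm (z - EuclideanSpace.single i 1) i
  have h2 := abs_coord_le_norm (z + EuclideanSpace.single i 1) i
  simp only [PiLp.add_apply, PiLp.sub_apply, PiLp.single_apply, if_true] at h1 h2
  rw [abs_sub_comm] at h1
  rw [add_comm] at h2
  have hpow : ∀ r : ℝ, 0 < r → r * r ^ (-(n : ℝ)) = r ^ (-((n : ℝ) - 1)) := by
    intro r hr
    nth_rewrite 1 [← Real.rpow_one r]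
    rw [← Real.rpow_add hr]
    congr 1
    ring
  have hterm : ∀ r a : ℝ, 0 < r → |a| ≤ r → |a * r ^ (-(n : ℝ))| ≤ r ^ (-((n : ℝ) - 1)) := by
    intro r a hr har
    rw [abs_mul, abs_of_nonneg (Real.rpow_nonneg hr.le (-(n : ℝ))), ← hpow r hr]
    exact mul_le_mul_of_nonneg_right har (Real.rpow_nonneg hr.le _)
  have h3 := hterm _ _ hpos h1
  have h4 := hterm _ _ (hpos.trans_le hle) h2
  have h5 := Real.rpow_le_rpow_of_nonpos hpos hle (by linarith : -((n : ℝ) - 1) ≤ 0)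
  exact (abs_sub _ _).trans (by linarith)

theorem hasDerivAt_green_kernel {n : ℕ} {i : Fin n} (c : ℝ) {z : Euc n} (hz : 0 < z i)
    (hze : z ≠ EuclideanSpace.single i 1) :
    HasDerivAt (fun t : ℝ => c * ‖z - t • EuclideanSpace.single i 1‖ ^ ((2 : ℝ) - n)
        - c * ‖z + t • EuclideanSpace.single i 1‖ ^ ((2 : ℝ) - n))
      (-(((n : ℝ) - 2) * c * ((1 - z i) * ‖z - EuclideanSpace.single i 1‖ ^ (-(n : ℝ))
        - (1 + z i) * ‖z + EuclideanSpace.single i 1‖ ^ (-(n : ℝ))))) 1 := by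
  have hze' : -z ≠ (1 : ℝ) • EuclideanSpace.single i 1 := by
    intro h
    have := congrArg (fun w : Euc n => w i) h
    simp at this
    linarith
  have h1 := hasDerivAt_norm_sub_smul_single_rpow i z (t := 1) (by simpa using hze) ((2 : ℝ) - n)
  have h2 := hasDerivAt_norm_sub_smul_single_rpow i (-z) (t := 1) hze' ((2 : ℝ) - n)
  have hneg : ∀ u : ℝ, ‖-z - u • EuclideanSpace.single i 1‖ = ‖z + u • EuclideanSpace.single i 1‖ := by
    intro u
    rw [← norm_neg, neg_sub, sub_neg_eq_add, add_comm]
  simp only [hneg] at h2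
  simp only [one_smul, PiLp.neg_apply, sub_neg_eq_add,
    show (2 : ℝ) - n - 2 = -(n : ℝ) by ring] at h1 h2
  refine ((h1.const_mul c).sub (h2.const_mul c)).congr_deriv ?_
  ring

theorem abs_green_kernel_sub_le {n : ℕ} (hn : 2 ≤ (n : ℝ)) {i : Fin n} {c : ℝ} (hc : 0 ≤ c)
    {z : Euc n} (hz : 0 ≤ z i) {t : ℝ} (ht : 0 ≤ t) (hzt : z ≠ t • EuclideanSpace.single i 1)
    (hze : z ≠ EuclideanSpace.single i 1) :
    |(c * ‖z - t • EuclideanSpace.single i 1‖ ^ ((2 : ℝ) - n)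
        - c * ‖z + t • EuclideanSpace.single i 1‖ ^ ((2 : ℝ) - n))
      - (c * ‖z - EuclideanSpace.single i 1‖ ^ ((2 : ℝ) - n)
        - c * ‖z + EuclideanSpace.single i 1‖ ^ ((2 : ℝ) - n))|
      ≤ |t - 1| * (2 * c * (n - 2) * ‖z - t • EuclideanSpace.single i 1‖ ^ (-((n : ℝ) - 1))
        + 2 * c * (n - 2) * ‖z - EuclideanSpace.single i 1‖ ^ (-((n : ℝ) - 1))) := by
  have p1 : 0 < ‖z - t • EuclideanSpace.single i 1‖ := norm_pos_iff.2 (sub_ne_zero.2 hzt)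
  have p2 : 0 < ‖z - EuclideanSpace.single i 1‖ := norm_pos_iff.2 (sub_ne_zero.2 hze)
  have l1 := norm_sub_smul_single_le_norm_add hz ht
  have l2 := norm_sub_single_le_norm_add hz
  have e1 : |‖z - t • EuclideanSpace.single i 1‖ - ‖z - EuclideanSpace.single i 1‖| ≤ |t - 1| := by
    refine (abs_norm_sub_norm_le _ _).trans (le_of_eq ?_)
    rw [show z - t • EuclideanSpace.single i 1 - (z - EuclideanSpace.single i 1) =
      (1 - t) • (EuclideanSpace.single i 1 : Euc n) by module, norm_smul, PiLp.norm_single]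
    simp [abs_sub_comm]
  have e2 : |‖z + t • EuclideanSpace.single i 1‖ - ‖z + EuclideanSpace.single i 1‖| ≤ |t - 1| := by
    refine (abs_norm_sub_norm_le _ _).trans (le_of_eq ?_)
    rw [show z + t • EuclideanSpace.single i 1 - (z + EuclideanSpace.single i 1) =
      (t - 1) • (EuclideanSpace.single i 1 : Euc n) by module, norm_smul, PiLp.norm_single]
    simp
  have hm : (0 : ℝ) ≤ n - 2 := by linarith
  have d1 := abs_rpow_neg_sub_rpow_neg_le hm p1 p2
  have d2 := abs_rpow_neg_sub_rpow_neg_le hm (p1.trans_le l1) (p2.trans_le l2)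
  rw [show (n : ℝ) - 2 + 1 = n - 1 by ring, show -((n : ℝ) - 2) = 2 - n by ring] at d1 d2
  have m1 := Real.rpow_le_rpow_of_nonpos p1 l1 (by linarith : -((n : ℝ) - 1) ≤ 0)
  have m2 := Real.rpow_le_rpow_of_nonpos p2 l2 (by linarith : -((n : ℝ) - 1) ≤ 0)
  set r1 := ‖z - t • EuclideanSpace.single i 1‖
  set r2 := ‖z - EuclideanSpace.single i 1‖
  set R1 := ‖z + t • EuclideanSpace.single i 1‖
  set R2 := ‖z + EuclideanSpace.single i 1‖
  have q1 : 0 ≤ r1 ^ (-((n : ℝ) - 1)) := Real.rpow_nonneg p1.le _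
  have q2 : 0 ≤ r2 ^ (-((n : ℝ) - 1)) := Real.rpow_nonneg p2.le _
  have b1 : |r1 ^ ((2 : ℝ) - n) - r2 ^ ((2 : ℝ) - n)|
      ≤ (n - 2) * (r1 ^ (-((n : ℝ) - 1)) + r2 ^ (-((n : ℝ) - 1))) * |t - 1| :=
    d1.trans (mul_le_mul_of_nonneg_left e1 (mul_nonneg hm (by linarith)))
  have b2 : |R1 ^ ((2 : ℝ) - n) - R2 ^ ((2 : ℝ) - n)|
      ≤ (n - 2) * (r1 ^ (-((n : ℝ) - 1)) + r2 ^ (-((n : ℝ) - 1))) * |t - 1| :=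
    d2.trans (mul_le_mul (mul_le_mul_of_nonneg_left (by linarith) hm) e2 (abs_nonneg _)
      (mul_nonneg hm (by linarith)))
  calc _ = |c * ((r1 ^ ((2 : ℝ) - n) - r2 ^ ((2 : ℝ) - n))
        - (R1 ^ ((2 : ℝ) - n) - R2 ^ ((2 : ℝ) - n)))| := by congr 1; ring
    _ ≤ c * (|r1 ^ ((2 : ℝ) - n) - r2 ^ ((2 : ℝ) - n)|
        + |R1 ^ ((2 : ℝ) - n) - R2 ^ ((2 : ℝ) - n)|) := by
        rw [abs_mul, abs_of_nonneg hc]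
        exact mul_le_mul_of_nonneg_left (abs_sub _ _) hc
    _ ≤ c * ((n - 2) * (r1 ^ (-((n : ℝ) - 1)) + r2 ^ (-((n : ℝ) - 1))) * |t - 1|
        + (n - 2) * (r1 ^ (-((n : ℝ) - 1)) + r2 ^ (-((n : ℝ) - 1))) * |t - 1|) :=
        mul_le_mul_of_nonneg_left (add_le_add b1 b2) hc
    _ = _ := by ring

/-- Differentiation under the integral sign for the Green potential of a density which is
singular at the pole of the kernel. -/
theorem hasDerivAt_green_potential {n : ℕ} (hn : 4 ≤ n) (i : Fin n) {c s C : ℝ} (hc : 0 ≤ c)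
    (hs : 0 ≤ s) (hs1 : s < 1) (hC : 0 ≤ C) {g : Euc n → ℝ}
    (hgm : AEStronglyMeasurable g (volume.restrict {z : Euc n | 0 < z i}))
    (hg : ∀ z ∈ {z : Euc n | 0 < z i}, z ≠ EuclideanSpace.single i 1 →
      |g z| ≤ C * cutProfile (n - 2) s ‖z - EuclideanSpace.single i 1‖)
    (hint : ∀ x : Euc n, 0 < x i → IntegrableOn (fun z =>
      (c * ‖z - x‖ ^ ((2 : ℝ) - n) - c * ‖z - reflct i x‖ ^ ((2 : ℝ) - n)) * g z)
      {z : Euc n | 0 < z i}) :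
    HasDerivAt (fun t : ℝ => ∫ z in {z : Euc n | 0 < z i},
        (c * ‖z - t • EuclideanSpace.single i 1‖ ^ ((2 : ℝ) - n)
          - c * ‖z - reflct i (t • EuclideanSpace.single i 1)‖ ^ ((2 : ℝ) - n)) * g z)
      (∫ z in {z : Euc n | 0 < z i},
        -(((n : ℝ) - 2) * c * ((1 - z i) * ‖z - EuclideanSpace.single i 1‖ ^ (-(n : ℝ))
          - (1 + z i) * ‖z + EuclideanSpace.single i 1‖ ^ (-(n : ℝ)))) * g z) 1 := by
  have hn4 : (4 : ℝ) ≤ n := by exact_mod_cast hn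
  have : Nontrivial (Euc n) := Module.nontrivial_of_finrank_pos (R := ℝ) (by simp; omega)
  set S : Set (Euc n) := {z : Euc n | 0 < z i} with hS_def
  have hS : MeasurableSet S := measurableSet_coord_pos i
  set e : Euc n := EuclideanSpace.single i 1 with he
  set k : ℝ → Euc n → ℝ := fun t z =>
    c * ‖z - t • e‖ ^ ((2 : ℝ) - n) - c * ‖z + t • e‖ ^ ((2 : ℝ) - n) with hk
  set Φ : ℝ → ℝ := cutProfile (n - 2) ((n - 1) + s) with hΦ
  have hΦint : ∀ x : Euc n, Integrable (fun z : Euc n => Φ ‖z - x‖) := fun x =>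
    integrable_cutProfile_norm_sub (by omega) (by linarith) (by linarith) x
  have hΦ0 : ∀ x : Euc n, 0 ≤ Φ ‖x‖ := fun x => cutProfile_nonneg (norm_nonneg x)
  set M : ℝ := 2 * c * (n - 2) * C with hM
  have hM0 : 0 ≤ M := mul_nonneg (mul_nonneg (mul_nonneg zero_le_two hc) (by linarith)) hC
  have hkm : ∀ t, Measurable (k t) := fun t => by
    simp only [hk]
    fun_prop
  have hk_int : ∀ t : ℝ, 0 < t → IntegrableOn (fun z => k t z * g z) S := by
    intro t ht
    have := hint (t • e) (by simpa [he] using ht)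
    simpa only [he, reflct_smul_single, sub_neg_eq_add] using this
  simp only [he, reflct_smul_single, sub_neg_eq_add]
  rw [← he, hasDerivAt_iff_tendsto_slope]
  have hslope : (fun t : ℝ => ∫ z, S.indicator (fun z => (t - 1)⁻¹ * (k t z - k 1 z) * g z) z)
      =ᶠ[𝓝[≠] 1] slope (fun t : ℝ => ∫ z in S, k t z * g z) 1 := by
    filter_upwards [mem_nhdsWithin_of_mem_nhds (lt_mem_nhds zero_lt_one)] with t ht
    rw [integral_indicator hS, slope_def_module, smul_eq_mul,
      ← integral_sub (hk_int t ht) (hk_int 1 one_pos), ← integral_const_mul]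
    congr 1 with z
    ring
  refine Tendsto.congr' hslope ?_
  rw [← integral_indicator hS]
  have hdom : ∀ t : ℝ, 0 < t → t ≠ 1 → ∀ z ∈ S, z ≠ t • e → z ≠ e →
      |(t - 1)⁻¹ * (k t z - k 1 z) * g z| ≤ M * (Φ ‖z - t • e‖ + Φ ‖z - e‖)
        + M * (Φ ‖z - e‖ + Φ ‖z - e‖) := by
    intro t ht ht1 z hz hzt hze
    have p1 : 0 < ‖z - t • e‖ := norm_pos_iff.2 (sub_ne_zero.2 hzt)
    have p2 : 0 < ‖z - e‖ := norm_pos_iff.2 (sub_ne_zero.2 hze)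
    have hD : 0 ≤ 2 * c * ((n : ℝ) - 2) := mul_nonneg (by linarith) (by linarith)
    have hKd : ∀ a : ℝ, 0 < a → |2 * c * (n - 2) * a ^ (-((n : ℝ) - 1)) * g z| ≤
        M * (Φ a + Φ ‖z - e‖) := fun a ha =>
      abs_mul_le_cutProfile (by linarith) hs (by linarith) hC ha p2
        (abs_of_nonneg (mul_nonneg hD (Real.rpow_nonneg ha.le _))).le (hg z hz hze)
    have hb := abs_green_kernel_sub_le (by linarith) hc (le_of_lt hz) ht.le hzt hze
    rw [← he] at hb
    have ht0 : 0 < |t - 1| := abs_pos.2 (sub_ne_zero.2 ht1)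
    have hq : |(t - 1)⁻¹ * (k t z - k 1 z)| ≤
        2 * c * (n - 2) * ‖z - t • e‖ ^ (-((n : ℝ) - 1))
          + 2 * c * (n - 2) * ‖z - e‖ ^ (-((n : ℝ) - 1)) := by
      rw [abs_mul, abs_inv, inv_mul_le_iff₀ ht0]
      simpa only [hk, one_smul] using hb
    rw [abs_mul]
    refine (mul_le_mul_of_nonneg_right hq (abs_nonneg _)).trans ?_
    rw [add_mul]
    have h1 := hKd _ p1
    have h2 := hKd _ p2
    rw [abs_mul, abs_of_nonneg (mul_nonneg hD (Real.rpow_nonneg p1.le _))] at h1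
    rw [abs_mul, abs_of_nonneg (mul_nonneg hD (Real.rpow_nonneg p2.le _))] at h2
    exact add_le_add h1 h2
  refine tendsto_integral_of_tendsto_dominating
    (H := fun t z => M * (Φ ‖z - t • e‖ + Φ ‖z - e‖) + M * (Φ ‖z - e‖ + Φ ‖z - e‖))
    (h := fun z => M * (Φ ‖z - e‖ + Φ ‖z - e‖) + M * (Φ ‖z - e‖ + Φ ‖z - e‖))
    ?_ ?_ ?_ ?_ ?_ ?_ ?_ ?_ ?_
  · refine Eventually.of_forall fun t => (aestronglyMeasurable_indicator_iff hS).2 ?_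
    exact ((((hkm t).sub (hkm 1)).const_mul _).aestronglyMeasurable).mul hgm
  · exact Eventually.of_forall fun t => (((hΦint _).add (hΦint _)).const_mul M).add
      (((hΦint _).add (hΦint _)).const_mul M)
  · exact (((hΦint _).add (hΦint _)).const_mul M).add (((hΦint _).add (hΦint _)).const_mul M)
  · filter_upwards [mem_nhdsWithin_of_mem_nhds (lt_mem_nhds zero_lt_one), self_mem_nhdsWithin]
      with t ht ht1
    filter_upwards [Measure.ae_ne volume (t • e), Measure.ae_ne volume e] with z hzt hze
    by_cases hz : z ∈ S
    · rw [Set.indicator_of_mem hz]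
      exact hdom t ht ht1 z hz hzt hze
    · rw [Set.indicator_of_notMem hz, abs_zero]
      exact add_nonneg (mul_nonneg hM0 (add_nonneg (hΦ0 _) (hΦ0 _)))
        (mul_nonneg hM0 (add_nonneg (hΦ0 _) (hΦ0 _)))
  · exact Eventually.of_forall fun t => Eventually.of_forall fun z =>
      add_nonneg (mul_nonneg hM0 (add_nonneg (hΦ0 _) (hΦ0 _)))
        (mul_nonneg hM0 (add_nonneg (hΦ0 _) (hΦ0 _)))
  · filter_upwards [Measure.ae_ne volume e] with z hze
    have hnn : 0 ≤ M * (Φ ‖z - e‖ + Φ ‖z - e‖) :=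
      mul_nonneg hM0 (add_nonneg (hΦ0 _) (hΦ0 _))
    by_cases hz : z ∈ S
    · rw [Set.indicator_of_mem hz]
      have p2 : 0 < ‖z - e‖ := norm_pos_iff.2 (sub_ne_zero.2 hze)
      have hb := abs_green_kernel_deriv_le (by linarith) (le_of_lt hz) hze
      rw [← he] at hb
      have hc2 : 0 ≤ ((n : ℝ) - 2) * c := mul_nonneg (by linarith) hc
      have := abs_mul_le_cutProfile (m := n - 2) (D := 2 * c * (n - 2)) (by linarith) hs
        (by linarith : (0 : ℝ) ≤ n - 1) hC p2 p2
        (K := -(((n : ℝ) - 2) * c * ((1 - z i) * ‖z - e‖ ^ (-(n : ℝ))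
          - (1 + z i) * ‖z + e‖ ^ (-(n : ℝ))))) (by
            rw [abs_neg, abs_mul, abs_of_nonneg hc2]
            refine (mul_le_mul_of_nonneg_left hb hc2).trans (le_of_eq ?_)
            ring) (hg z hz hze)
      exact this.trans (le_add_of_nonneg_right hnn)
    · rw [Set.indicator_of_notMem hz, abs_zero]
      exact add_nonneg hnn hnn
  · filter_upwards [Measure.ae_ne volume e] with z hze
    by_cases hz : z ∈ S
    · simp only [Set.indicator_of_mem hz]
      have hd := hasDerivAt_iff_tendsto_slope.1 (hasDerivAt_green_kernel c hz hze)
      refine Tendsto.mul_const _ (hd.congr fun t => ?_)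
      rw [slope_def_module, smul_eq_mul]
    · simp only [Set.indicator_of_notMem hz]
      exact tendsto_const_nhds
  · filter_upwards [Measure.ae_ne volume e] with z hze
    have p2 : 0 < ‖z - e‖ := norm_pos_iff.2 (sub_ne_zero.2 hze)
    have hcont : ContinuousAt (fun t : ℝ => Φ ‖z - t • e‖) 1 := by
      refine ContinuousAt.comp (g := Φ) (f := fun t : ℝ => ‖z - t • e‖) ?_ (by fun_prop)
      rw [one_smul]
      exact continuousAt_cutProfile p2
    have ht : Tendsto (fun t : ℝ => Φ ‖z - t • e‖) (𝓝[≠] 1) (𝓝 (Φ ‖z - e‖)) := by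
      have := hcont.tendsto
      rw [one_smul] at this
      exact this.mono_left nhdsWithin_le_nhds
    exact ((ht.add_const _).const_mul M).add_const _
  · refine tendsto_const_nhds.congr fun t => ?_
    have htr : ∀ x : Euc n, ∫ z, Φ ‖z - x‖ = ∫ z : Euc n, Φ ‖z‖ := fun x =>
      integral_sub_right_eq_self (fun z : Euc n => Φ ‖z‖) x
    have hsplit : ∀ x : Euc n, ∫ z, (M * (Φ ‖z - x‖ + Φ ‖z - e‖) + M * (Φ ‖z - e‖ + Φ ‖z - e‖)) =
        M * ((∫ z : Euc n, Φ ‖z‖) + ∫ z : Euc n, Φ ‖z‖)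
          + M * ((∫ z : Euc n, Φ ‖z‖) + ∫ z : Euc n, Φ ‖z‖) := by
      intro x
      have hpair : ∀ x : Euc n, Integrable fun z => M * (Φ ‖z - x‖ + Φ ‖z - e‖) := fun x =>
        ((hΦint x).add (hΦint e)).const_mul M
      rw [integral_add (hpair x) (hpair e), integral_const_mul, integral_const_mul,
        integral_add (hΦint x) (hΦint e), integral_add (hΦint e) (hΦint e), htr, htr]
    rw [hsplit e, hsplit (t • e)]

theorem one_add_norm_le_mul_norm_sub {n : ℕ} {i : Fin n} {x y : Euc n} (hx : 0 < x i)
    (hy : y i = 0) : 1 + ‖y‖ ≤ (1 + (1 + ‖x‖) / x i) * ‖y - x‖ := by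
  have h1 : x i ≤ ‖y - x‖ := by
    have := (neg_le_abs _).trans (abs_coord_le_norm (y - x) i)
    simp only [PiLp.sub_apply, hy] at this
    linarith
  have h2 : ‖y‖ ≤ ‖y - x‖ + ‖x‖ := by simpa using norm_add_le (y - x) x
  have h3 : 1 + ‖x‖ ≤ (1 + ‖x‖) / x i * ‖y - x‖ := by
    rw [div_mul_eq_mul_div, le_div_iff₀ hx]
    exact mul_le_mul_of_nonneg_left h1 (by positivity)
  linarith

theorem norm_sub_rpow_neg_le {n : ℕ} {y x : Euc n} {D r : ℝ} (hD : 0 < D) (hr : 0 ≤ r)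
    (h : 1 + ‖y‖ ≤ D * ‖y - x‖) : ‖y - x‖ ^ (-r) ≤ D ^ r * (1 + ‖y‖) ^ (-r) := by
  have h0 : 0 < 1 + ‖y‖ := by positivity
  have := Real.rpow_le_rpow_of_nonpos h0 h (by linarith : -r ≤ 0)
  rw [Real.mul_rpow hD.le (norm_nonneg _)] at this
  have hDr : 0 < D ^ r := Real.rpow_pos_of_pos hD r
  calc ‖y - x‖ ^ (-r) = D ^ r * (D ^ (-r) * ‖y - x‖ ^ (-r)) := by
        rw [← mul_assoc, ← Real.rpow_add hD, add_neg_cancel, Real.rpow_zero, one_mul]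
    _ ≤ _ := mul_le_mul_of_nonneg_left this hDr.le

theorem norm_sub_single_rpow_neg_le_one {n : ℕ} {i : Fin n} {y : Euc n} (hy : y i = 0) {q : ℝ}
    (hq : 0 ≤ q) : ‖y - EuclideanSpace.single i 1‖ ^ (-q) ≤ 1 := by
  refine Real.rpow_le_one_of_one_le_of_nonpos ?_ (by linarith)
  have := (neg_le_abs _).trans (abs_coord_le_norm (y - EuclideanSpace.single i 1) i)
  simp only [PiLp.sub_apply, PiLp.single_apply, if_true, hy] at this
  linarith

theorem integrableOn_poisson_kernel_mul {n : ℕ} (i : Fin n) {q : ℝ} (hq : 0 ≤ q) {x : Euc n}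
    (hx : 0 < x i) :
    IntegrableOn (fun y => (x i / ‖x - y‖ ^ (n : ℝ)) * ‖y - EuclideanSpace.single i 1‖ ^ (-q))
      {z : Euc n | z i = 0} (surf n) := by
  refine Integrable.mono' ((integrableOn_hyperplane_one_add_norm i
    (by linarith : (n : ℝ) - 1 < n)).const_mul (x i * (1 + (1 + ‖x‖) / x i) ^ (n : ℝ)))
    (Measurable.aestronglyMeasurable (by fun_prop)) ?_
  refine (ae_restrict_iff' (measurableSet_coord_eq_zero i)).2 (Eventually.of_forall fun y hy => ?_)
  have hD : 0 < 1 + (1 + ‖x‖) / x i := by positivity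
  have h1 := norm_sub_rpow_neg_le hD (Nat.cast_nonneg n) (one_add_norm_le_mul_norm_sub hx hy)
  have h2 := norm_sub_single_rpow_neg_le_one hy hq
  rw [Real.norm_of_nonneg (by positivity), norm_sub_rev x y, div_eq_mul_inv,
    ← Real.rpow_neg (norm_nonneg _)]
  refine (mul_le_of_le_one_right (by positivity) h2).trans ?_
  rw [mul_assoc]
  exact mul_le_mul_of_nonneg_left h1 hx.le

theorem hasDerivAt_poisson_integral {n : ℕ} (i : Fin n) {q : ℝ} (hq : 0 ≤ q) :
    IntegrableOn (fun y : Euc n => ‖y - EuclideanSpace.single i 1‖ ^ (-(q + n))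
        - (n : ℝ) * ‖y - EuclideanSpace.single i 1‖ ^ (-(q + n + 2)))
      {z : Euc n | z i = 0} (surf n) ∧
    HasDerivAt (fun t : ℝ => ∫ y in {z : Euc n | z i = 0},
        ((t • (EuclideanSpace.single i 1 : Euc n)) i
          / ‖t • EuclideanSpace.single i 1 - y‖ ^ (n : ℝ))
          * ‖y - EuclideanSpace.single i 1‖ ^ (-q) ∂(surf n))
      (∫ y in {z : Euc n | z i = 0}, (‖y - EuclideanSpace.single i 1‖ ^ (-(q + n))
        - (n : ℝ) * ‖y - EuclideanSpace.single i 1‖ ^ (-(q + n + 2))) ∂(surf n)) 1 := by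
  set e : Euc n := EuclideanSpace.single i 1 with he
  have hei : ∀ t : ℝ, (t • e) i = t := fun t => by simp [he]
  have hT := measurableSet_coord_eq_zero i
  set F' : ℝ → Euc n → ℝ := fun t y => (‖y - t • e‖ ^ (-(n : ℝ))
    - n * t ^ 2 * ‖y - t • e‖ ^ (-(n : ℝ) - 2)) * ‖y - e‖ ^ (-q) with hF'
  have hpos : ∀ t : ℝ, 0 < t → ∀ y : Euc n, y i = 0 → t ≤ ‖y - t • e‖ := by
    intro t ht y hy
    have := (neg_le_abs _).trans (abs_coord_le_norm (y - t • e) i)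
    simp only [PiLp.sub_apply, hy, hei] at this
    linarith
  have hmain := hasDerivAt_integral_of_dominated_loc_of_deriv_le (𝕜 := ℝ)
    (μ := (surf n).restrict {z : Euc n | z i = 0}) (x₀ := (1 : ℝ)) (s := Set.Ioo (1 / 2) 2)
    (F := fun t y => ((t • e) i / ‖t • e - y‖ ^ (n : ℝ)) * ‖y - e‖ ^ (-q)) (F' := F')
    (bound := fun y => (1 + n) * 7 ^ (n : ℝ) * (1 + ‖y‖) ^ (-(n : ℝ)))
    (Ioo_mem_nhds (by norm_num) (by norm_num))
    (Eventually.of_forall fun t => Measurable.aestronglyMeasurable (by fun_prop))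
    (integrableOn_poisson_kernel_mul i hq (by simp [he]))
    (Measurable.aestronglyMeasurable (by simp only [hF']; fun_prop))
    ((ae_restrict_iff' hT).2 (Eventually.of_forall fun y hy t ht => ?_))
    ((integrableOn_hyperplane_one_add_norm i (by linarith)).const_mul _)
    ((ae_restrict_iff' hT).2 (Eventually.of_forall fun y hy t ht => ?_))
  · have hF1 : ∀ y ∈ {z : Euc n | z i = 0}, F' 1 y =
        ‖y - e‖ ^ (-(q + n)) - (n : ℝ) * ‖y - e‖ ^ (-(q + n + 2)) := by
      intro y hy
      have h1 : 0 < ‖y - e‖ := by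
        have := hpos 1 one_pos y hy
        rw [one_smul] at this
        linarith
      simp only [hF', one_smul]
      rw [show -(q + n) = -(n : ℝ) + -q by ring, show -(q + n + 2) = (-(n : ℝ) - 2) + -q by ring,
        Real.rpow_add h1, Real.rpow_add h1]
      ring
    rw [setIntegral_congr_fun hT hF1] at hmain
    exact ⟨(integrableOn_congr_fun hF1 hT).1 hmain.1, hmain.2⟩
  · have ht0 : 0 < t := by linarith [ht.1]
    have hle := hpos t ht0 y hy
    have hp : 0 < ‖y - t • e‖ := ht0.trans_le hle
    have hte : ‖t • e‖ = t := by rw [norm_smul, he, PiLp.norm_single]; simp [ht0.le]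
    have hD : 1 + ‖y‖ ≤ 7 * ‖y - t • e‖ := by
      refine (one_add_norm_le_mul_norm_sub (i := i) (x := t • e) (by rw [hei]; exact ht0) hy).trans
        (mul_le_mul_of_nonneg_right ?_ (norm_nonneg _))
      rw [hte, hei]
      have : (1 + t) / t ≤ 6 := by
        rw [div_le_iff₀ ht0]
        linarith [ht.1]
      linarith
    have h1 := norm_sub_rpow_neg_le (by norm_num) (Nat.cast_nonneg n) hD
    have h2 := norm_sub_single_rpow_neg_le_one hy hq
    have h3 : t ^ 2 * ‖y - t • e‖ ^ (-(n : ℝ) - 2) ≤ ‖y - t • e‖ ^ (-(n : ℝ)) := by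
      have : ‖y - t • e‖ ^ (-(n : ℝ)) = ‖y - t • e‖ ^ 2 * ‖y - t • e‖ ^ (-(n : ℝ) - 2) := by
        rw [← Real.rpow_natCast, ← Real.rpow_add hp]
        congr 1
        push_cast
        ring
      rw [this]
      gcongr
    have h4 : |‖y - t • e‖ ^ (-(n : ℝ)) - n * t ^ 2 * ‖y - t • e‖ ^ (-(n : ℝ) - 2)|
        ≤ (1 + n) * ‖y - t • e‖ ^ (-(n : ℝ)) := by
      refine (abs_sub _ _).trans ?_
      rw [abs_of_nonneg (by positivity), abs_of_nonneg (by positivity), mul_assoc (n : ℝ)]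
      linarith [mul_le_mul_of_nonneg_left h3 (Nat.cast_nonneg (α := ℝ) n)]
    simp only [hF']
    rw [norm_mul, Real.norm_eq_abs, Real.norm_of_nonneg (Real.rpow_nonneg (norm_nonneg _) _)]
    refine (mul_le_of_le_one_right (abs_nonneg _) h2).trans (h4.trans ?_)
    rw [mul_assoc]
    exact mul_le_mul_of_nonneg_left h1 (by positivity)
  · have ht0 : 0 < t := by linarith [ht.1]
    have hp : 0 < ‖y - t • e‖ := ht0.trans_le (hpos t ht0 y hy)
    have hd := hasDerivAt_norm_sub_smul_single_rpow i y (sub_ne_zero.1 (norm_pos_iff.1 hp))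
      (-(n : ℝ))
    have hy0 : y i = 0 := hy
    have heq : (fun u : ℝ => (u • e) i / ‖u • e - y‖ ^ (n : ℝ) * ‖y - e‖ ^ (-q)) =
        fun u : ℝ => u * ‖y - u • e‖ ^ (-(n : ℝ)) * ‖y - e‖ ^ (-q) := by
      funext u
      rw [hei, norm_sub_rev, Real.rpow_neg (norm_nonneg (y - u • e)) (n : ℝ), div_eq_mul_inv]
    rw [heq]
    refine (((hasDerivAt_id t).mul hd).mul_const _).congr_deriv ?_
    simp only [hF', hy0, id, he]
    ring

/-- Explicit formula for the `x_n`-derivative at `e_n` of the rescaled limit profile `W₀`. -/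
theorem derivative_formula_for_W0
    (n : ℕ) (hn : 5 ≤ n) (i : Fin n) (hi : (i : ℕ) = n - 1)
    (p : ℝ) (hp1 : 1 ≤ p) (hp2 : p < ((n : ℝ) - 1) / ((n : ℝ) - 2))
    (g : Euc n → ℝ)
    (hg : ∀ z : Euc n, z ≠ EuclideanSpace.single i 1 →
      g z = cGreen n ^ p * ‖z - EuclideanSpace.single i 1‖ ^ (-(((n : ℝ) - 2) * p))
        - (cGreen n * ‖z - EuclideanSpace.single i 1‖ ^ ((2 : ℝ) - n)
            - cGreen n * ‖z + EuclideanSpace.single i 1‖ ^ ((2 : ℝ) - n)) ^ p)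
    (W₀ : Euc n → ℝ)
    (hW : ∀ x : Euc n, W₀ x =
      (∫ z in {z : Euc n | 0 < z i},
        (cGreen n * ‖z - x‖ ^ ((2 : ℝ) - n)
          - cGreen n * ‖z - reflct i x‖ ^ ((2 : ℝ) - n)) * g z)
      + 2 * ((n : ℝ) - 2) * cGreen n * alpha1 n p *
          ∫ y in {z : Euc n | z i = 0},
            (x i / ‖x - y‖ ^ (n : ℝ))
              * ‖y - EuclideanSpace.single i 1‖ ^ (-(((n : ℝ) - 2) * p - 2)) ∂(surf n)) :
    (∀ x : Euc n, 0 < x i →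
      IntegrableOn (fun z =>
          (cGreen n * ‖z - x‖ ^ ((2 : ℝ) - n)
            - cGreen n * ‖z - reflct i x‖ ^ ((2 : ℝ) - n)) * g z)
        {z : Euc n | 0 < z i} volume ∧
      IntegrableOn (fun y =>
          (x i / ‖x - y‖ ^ (n : ℝ))
            * ‖y - EuclideanSpace.single i 1‖ ^ (-(((n : ℝ) - 2) * p - 2)))
        {z : Euc n | z i = 0} (surf n)) ∧
    IntegrableOn (fun y : Euc n =>
        ‖y - EuclideanSpace.single i 1‖ ^ (-(((n : ℝ) - 2) * (p + 1)))
          - (n : ℝ) * ‖y - EuclideanSpace.single i 1‖ ^ (-(((n : ℝ) - 2) * p + n)))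
      {z : Euc n | z i = 0} (surf n) ∧
    IntegrableOn (fun z : Euc n =>
        ((1 - z i) * ‖z - EuclideanSpace.single i 1‖ ^ (-(n : ℝ))
          - (1 + z i) * ‖z + EuclideanSpace.single i 1‖ ^ (-(n : ℝ))) * g z)
      {z : Euc n | 0 < z i} volume ∧
    HasDerivAt (fun t : ℝ => W₀ (t • (EuclideanSpace.single i 1 : Euc n)))
      (2 * ((n : ℝ) - 2) * cGreen n * alpha1 n p *
        (∫ y in {z : Euc n | z i = 0},
          (‖y - EuclideanSpace.single i 1‖ ^ (-(((n : ℝ) - 2) * (p + 1)))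
            - (n : ℝ) * ‖y - EuclideanSpace.single i 1‖ ^ (-(((n : ℝ) - 2) * p + n)))
          ∂(surf n))
      - ((n : ℝ) - 2) * cGreen n *
        ∫ z in {z : Euc n | 0 < z i},
          ((1 - z i) * ‖z - EuclideanSpace.single i 1‖ ^ (-(n : ℝ))
            - (1 + z i) * ‖z + EuclideanSpace.single i 1‖ ^ (-(n : ℝ))) * g z)
      1 := by
  have hn5 : (5 : ℝ) ≤ n := by exact_mod_cast hn
  have hc : 0 ≤ cGreen n :=
    div_nonneg zero_le_one (mul_nonneg (by linarith) ENNReal.toReal_nonneg)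
  have hs0 : 0 ≤ ((n : ℝ) - 2) * (p - 1) := mul_nonneg (by linarith) (by linarith)
  have hs1 : ((n : ℝ) - 2) * (p - 1) < 1 := by
    rw [lt_div_iff₀ (by linarith)] at hp2
    linarith
  have hq : 0 ≤ ((n : ℝ) - 2) * p - 2 := by linarith
  have hC : 0 ≤ cGreen n ^ p * p := mul_nonneg (Real.rpow_nonneg hc p) (by linarith)
  have hgb : ∀ z ∈ {z : Euc n | 0 < z i}, z ≠ EuclideanSpace.single i 1 → |g z| ≤
      cGreen n ^ p * p *
        cutProfile (n - 2) ((n - 2) * (p - 1)) ‖z - EuclideanSpace.single i 1‖ := by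
    intro z hz hze
    rw [hg z hze]
    exact abs_green_power_defect_le (by linarith) hc hp1 hz hze
  have hgm : AEStronglyMeasurable g (volume.restrict {z : Euc n | 0 < z i}) := by
    have : Nontrivial (Euc n) := Module.nontrivial_of_finrank_pos (R := ℝ) (by simp; omega)
    refine (Measurable.aestronglyMeasurable ?_).congr (ae_restrict_of_ae
      ((Measure.ae_ne volume (EuclideanSpace.single i 1)).mono fun z hz => (hg z hz).symm))
    fun_prop
  have hS : MeasurableSet {z : Euc n | 0 < z i} := measurableSet_coord_pos i
  have hbulk : ∀ x : Euc n, 0 < x i → IntegrableOn (fun z =>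
      (cGreen n * ‖z - x‖ ^ ((2 : ℝ) - n) - cGreen n * ‖z - reflct i x‖ ^ ((2 : ℝ) - n)) * g z)
      {z : Euc n | 0 < z i} volume := fun x hx =>
    integrableOn_mul_of_le_cutProfile (by omega) hS (by linarith) hs0
      (by linarith : (0 : ℝ) ≤ n - 2) hC (by linarith) (by linarith)
      (Measurable.aestronglyMeasurable (by fun_prop)) hgm
      (fun z hz hzx => abs_green_kernel_le (by linarith) hc hx.le (le_of_lt hz) hzx) hgb
  obtain ⟨hpint, hpder⟩ := hasDerivAt_poisson_integral i hq
  rw [show ((n : ℝ) - 2) * (p + 1) = ((n : ℝ) - 2) * p - 2 + n by ring,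
    show ((n : ℝ) - 2) * p + n = ((n : ℝ) - 2) * p - 2 + n + 2 by ring]
  refine ⟨fun x hx => ⟨hbulk x hx, integrableOn_poisson_kernel_mul i hq hx⟩, hpint, ?_, ?_⟩
  · exact integrableOn_mul_of_le_cutProfile (by omega) hS (by linarith) hs0
      (by linarith : (0 : ℝ) ≤ n - 1) hC (by linarith) (by linarith)
      (Measurable.aestronglyMeasurable (by fun_prop)) hgm
      (fun z hz hze => abs_green_kernel_deriv_le (by linarith) (le_of_lt hz) hze) hgb
  · have hder := hasDerivAt_green_potential (by omega) i hc hs0 hs1 hC hgm hgb hbulk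
    have hconst : (∫ z in {z : Euc n | 0 < z i},
        -(((n : ℝ) - 2) * cGreen n * ((1 - z i) * ‖z - EuclideanSpace.single i 1‖ ^ (-(n : ℝ))
          - (1 + z i) * ‖z + EuclideanSpace.single i 1‖ ^ (-(n : ℝ)))) * g z) =
        -(((n : ℝ) - 2) * cGreen n * ∫ z in {z : Euc n | 0 < z i},
          ((1 - z i) * ‖z - EuclideanSpace.single i 1‖ ^ (-(n : ℝ))
            - (1 + z i) * ‖z + EuclideanSpace.single i 1‖ ^ (-(n : ℝ))) * g z) := by
      rw [← integral_const_mul, ← integral_neg]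
      congr 1 with z
      ring
    rw [hconst] at hder
    simp only [hW]
    refine (hder.add (hpder.const_mul _)).congr_deriv ?_
    ring
end
end
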